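/- arXiv:1912.01104 — 4 statements merged into one kernel-verified Lean document; each statement's English description precedes it below -/
import Mathlib

section
/- For every positive integer n there exists m ∈ {2, 3, 4} such that the full matrix ring 𝕄ₙ(𝔽₂) is almost m-torsion clean. In fact, every matrix A ∈ 𝕄ₙ(𝔽₂) can be written as A = E + U where E is an idempotent matrix and U is a matrix with U⁴ = I, so 𝕄ₙ(𝔽₂) is almost 4-torsion clean for every n ≥ 1. -/
def AlmostTorsionClean (R : Type*) [Ring R] (m : ℕ) : Prop :=
  ∀ r : R, ∃ u e : R, IsUnit u ∧ u ^ m = 1 ∧ e * e = e ∧ r = u + e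

def TorsionClean (R : Type*) [Ring R] (m : ℕ) : Prop :=
  AlmostTorsionClean R m ∧ ∀ k : ℕ, 0 < k → k < m → ¬ AlmostTorsionClean R k

theorem aux_basis {V : Type*} [AddCommGroup V] [Module (ZMod 2) V]
    (f : Module.End (ZMod 2) V) (m : ℕ) (v : V)
    (hspan : ⊤ ≤ Submodule.span (ZMod 2) (Set.range fun i : Fin (m+1) => (f ^ (i : ℕ)) v))
    (hfin : Module.finrank (ZMod 2) V = m + 1) (a : ℕ → ZMod 2) :
    ∃ b : Module.Basis (Fin (m+1)) (ZMod 2) V,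
      (∀ i : Fin m, f (b i.succ) = a (i+1) • b i.succ + b i.castSucc) ∧
      (b.repr (f (b 0)) 0 + ∑ i ∈ Finset.range m, a (i+1) = LinearMap.trace (ZMod 2) V f) := by
  let q : ℕ → V := fun i => Nat.rec v (fun i x => f x - a (m - i) • x) i
  have q0 : q 0 = v := rfl
  have qs : ∀ i, q (i+1) = f (q i) - a (m - i) • q i := fun i => rfl
  let W : ℕ → Submodule (ZMod 2) V := fun k => Submodule.span (ZMod 2) (q '' {i | i < k})
  have hW : ∀ k, ∀ x ∈ W k, f x ∈ W (k+1) := by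
    intro k x hx
    have : W k ≤ (W (k+1)).comap f := by
      refine Submodule.span_le.2 ?_
      rintro _ ⟨i, hi, rfl⟩
      simp only [Set.mem_ofPred_eq] at hi
      have h1 : q (i+1) ∈ W (k+1) := Submodule.subset_span ⟨i+1, by simpa using hi, rfl⟩
      have h2 : q i ∈ W (k+1) := Submodule.subset_span ⟨i, by simp; omega, rfl⟩
      have h3 : f (q i) = q (i+1) + a (m-i) • q i := by rw [qs]; abel
      change f (q i) ∈ W (k+1)
      rw [h3]
      exact add_mem h1 (Submodule.smul_mem _ _ h2)
    exact this hx
  have hpow : ∀ k, (f ^ k) v ∈ W (k+1) := by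
    intro k
    induction k with
    | zero => exact Submodule.subset_span ⟨0, by simp, rfl⟩
    | succ k ih =>
      rw [pow_succ']
      exact hW _ _ ih
  let c : Fin (m+1) → V := fun d => q (m - d)
  have hc : ⊤ ≤ Submodule.span (ZMod 2) (Set.range c) := by
    refine hspan.trans (Submodule.span_le.2 ?_)
    rintro _ ⟨i, rfl⟩
    refine Submodule.span_mono ?_ (hpow i)
    rintro _ ⟨j, hj, rfl⟩
    simp only [Set.mem_ofPred_eq] at hj
    refine ⟨⟨m - j, by omega⟩, ?_⟩
    have : m - (m - j) = j := by omega
    simp only [c, this]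
  let b := basisOfTopLeSpanOfCardEqFinrank c hc (by simp [hfin])
  have hb : ∀ d, b d = q (m - d) := fun d => by simp [b, c]
  have h1 : ∀ i : Fin m, f (b i.succ) = a (i+1) • b i.succ + b i.castSucc := by
    intro i
    have e1 : m - (i.castSucc : ℕ) = (m - (i.succ : ℕ)) + 1 := by
      simp; omega
    have e2 : m - (m - (i.succ : ℕ)) = i + 1 := by
      simp; omega
    rw [hb, hb, e1, qs, e2]
    abel
  refine ⟨b, h1, ?_⟩
  rw [LinearMap.trace_eq_matrix_trace (ZMod 2) b, Matrix.trace, Fin.sum_univ_succ]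
  simp only [Matrix.diag_apply, LinearMap.toMatrix_apply]
  congr 1
  rw [Finset.sum_range]
  refine Finset.sum_congr rfl fun i _ => ?_
  rw [h1]
  simp [Finsupp.single_apply, Fin.ext_iff]

theorem zmod2_cases (x : ZMod 2) : x = 0 ∨ x = 1 := by
  revert x; decide

theorem aux_build {V : Type*} [AddCommGroup V] [Module (ZMod 2) V]
    (f : Module.End (ZMod 2) V) (m : ℕ) (a : ℕ → ZMod 2) (ε : ZMod 2)
    (b : Module.Basis (Fin (m+1)) (ZMod 2) V)
    (h1 : ∀ i : Fin m, f (b i.succ) = a (i+1) • b i.succ + b i.castSucc)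
    (h0 : b.repr (f (b 0)) 0 = ε)
    (hodd : ∀ i, i + 1 < m → i % 2 = 0 → a (i+1) = 1 - ε)
    (heven : ∀ i, i < m → i % 2 = 1 → a (i+1) = ε)
    (hlast : m = 1 → a 1 = 1 - ε) :
    ∃ e : Module.End (ZMod 2) V, e * e = e ∧ (f - e) ^ 4 = 0 := by
  classical
  set c := b.repr (f (b 0)) with hc
  let good : Fin m → Prop := fun i => (i : ℕ) % 2 = 0 ∧ a (i+1) = 1 - ε
  let u : V := ∑ i : Fin m, if good i then c i.succ • b i.succ else 0
  let w : V := ∑ i : Fin m, if good i then 0 else c i.succ • b i.succ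
  have hf0 : f (b 0) = ε • b 0 + u + w := by
    have := b.sum_repr (f (b 0))
    rw [← this, Fin.sum_univ_succ, ← hc, h0, add_assoc]
    congr 1
    rw [← Finset.sum_add_distrib]
    refine Finset.sum_congr rfl fun i _ => ?_
    split_ifs <;> simp
  let E : Module.End (ZMod 2) V := b.constr (ZMod 2)
    (Fin.cons (ε • b 0 + u) (fun i : Fin m => a (i+1) • b i.succ +
      if (i : ℕ) % 2 = 1 then b i.castSucc else 0))
  have hE0 : E (b 0) = ε • b 0 + u := by
    simp [E, Module.Basis.constr_basis]
  have hEs : ∀ i : Fin m, E (b i.succ) = a (i+1) • b i.succ +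
      if (i : ℕ) % 2 = 1 then b i.castSucc else 0 := by
    intro i
    simp [E, Module.Basis.constr_basis]
  have hεε : ∀ x : ZMod 2, x * x = x := by decide
  have hεε' : ∀ x : ZMod 2, x * (1 - x) = 0 := by decide
  have hEu : E u = (1 - ε) • u := by
    simp only [u, map_sum, Finset.smul_sum]
    refine Finset.sum_congr rfl fun i _ => ?_
    split_ifs with h
    · rw [map_smul, hEs, h.2, if_neg (by have := h.1; omega), add_zero, smul_comm]
    · simp
  have hN0 : (f - E) (b 0) = w := by
    rw [LinearMap.sub_apply, hE0, hf0]; abel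
  have hNs : ∀ i : Fin m, (f - E) (b i.succ) = if (i : ℕ) % 2 = 1 then 0 else b i.castSucc := by
    intro i
    rw [LinearMap.sub_apply, hEs, h1]
    split_ifs <;> simp
  have hcast : ∀ i : Fin m, (i : ℕ) ≠ 0 → ∃ j : Fin m, (j : ℕ) + 1 = i ∧ i.castSucc = j.succ := by
    intro i hi
    refine ⟨⟨i - 1, by omega⟩, by simp; omega, ?_⟩
    ext; simp; omega
  have hNw : (f - E) ((f - E) w) = 0 := by
    simp only [w, map_sum]
    refine Finset.sum_eq_zero fun i _ => ?_
    split_ifs with h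
    · simp
    · rw [map_smul, map_smul, hNs]
      split_ifs with h2
      · simp
      · have h3 : (i : ℕ) ≠ 0 := by
          intro h3
          apply h
          refine ⟨by omega, ?_⟩
          by_cases hm : m = 1
          · rw [h3]; exact hlast hm
          · exact hodd _ (by omega) (by omega)
        obtain ⟨j, hj, hj'⟩ := hcast i h3
        rw [hj', hNs, if_pos (by omega), smul_zero]
  refine ⟨E, ?_, ?_⟩
  · refine b.ext fun d => ?_
    rw [Module.End.mul_apply]
    refine Fin.cases ?_ (fun i => ?_) d
    · rw [hE0, map_add, map_smul, hE0, hEu, smul_add, smul_smul, hεε, add_assoc, ← add_smul]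
      simp
    · rw [hEs, map_add, map_smul, hEs]
      split_ifs with h
      · obtain ⟨j, hj, hj'⟩ := hcast i (by omega)
        have : E (b i.castSucc) = (1 - ε) • b i.castSucc := by
          rw [hj', hEs, if_neg (by omega), hodd _ (by omega) (by omega), add_zero]
        rw [this, smul_add, smul_smul, hεε, add_assoc, ← add_smul, heven _ i.2 h]
        simp
      · simp [smul_smul, hεε]
  · refine b.ext fun d => ?_
    have key : (f - E) ((f - E) ((f - E) (b 0))) = 0 := by rw [hN0, hNw]
    have : ((f - E) ^ 4) (b d) = (f - E) ((f - E) ((f - E) ((f - E) (b d)))) := by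
      simp only [pow_succ, pow_zero, one_mul, Module.End.mul_apply]
    rw [this, LinearMap.zero_apply]
    refine Fin.cases ?_ (fun i => ?_) d
    · rw [key, map_zero]
    · rw [hNs]
      split_ifs with h
      · simp
      · by_cases h0 : (i : ℕ) = 0
        · have : i.castSucc = 0 := by ext; simpa using h0
          rw [this, key]
        · obtain ⟨j, hj, hj'⟩ := hcast i h0
          rw [hj', hNs, if_pos (by omega)]
          simp

theorem sum_pairs (a : ℕ → ZMod 2) (k : ℕ) (h : ∀ i < k, a (2*i+1) + a (2*i+2) = 1) :
    ∑ i ∈ Finset.range (2*k), a (i+1) = k := by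
  induction k with
  | zero => simp
  | succ k ih =>
    rw [show 2*(k+1) = 2*k+1+1 by ring, Finset.sum_range_succ, Finset.sum_range_succ,
      ih fun i hi => h i (by omega), add_assoc, h k (by omega)]
    simp

theorem aux_cyclic {V : Type*} [AddCommGroup V] [Module (ZMod 2) V]
    (f : Module.End (ZMod 2) V) (n : ℕ) (v : V)
    (hspan : ⊤ ≤ Submodule.span (ZMod 2) (Set.range fun i : Fin n => (f ^ (i : ℕ)) v))
    (hfin : Module.finrank (ZMod 2) V = n) :
    ∃ e : Module.End (ZMod 2) V, e * e = e ∧ (f - e) ^ 4 = 0 := by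
  rcases n with _ | m
  · have hz : ∀ x : V, x = 0 := by
      intro x
      have := hspan (Submodule.mem_top (x := x))
      simpa using this
    exact ⟨0, by simp, LinearMap.ext fun x => by rw [hz x]; simp⟩
  set t := LinearMap.trace (ZMod 2) V f with ht
  obtain ⟨k, rfl | rfl⟩ := m.even_or_odd'
  · let ε : ZMod 2 := t - k
    let a : ℕ → ZMod 2 := fun d => if d % 2 = 0 then ε else 1 - ε
    obtain ⟨b, h1, h2⟩ := aux_basis f _ v hspan hfin a
    rw [sum_pairs a k fun i _ => by simp [a, Nat.add_mod]] at h2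
    refine aux_build f _ a ε b h1 (eq_sub_of_add_eq h2) ?_ ?_ (by omega)
    · intro i hi h
      simp only [a]; rw [if_neg (by omega)]
    · intro i hi h
      simp only [a]; rw [if_pos (by omega)]
  · by_cases hk : k = 0 ∧ t = 0
    · obtain ⟨rfl, h0⟩ := hk
      obtain ⟨b, h1, h2⟩ := aux_basis f _ v hspan hfin 0
      rw [← ht, h0] at h2
      simp only [Pi.zero_apply, Finset.sum_const_zero, add_zero] at h2
      have h3 : f (b 1) = b 0 := by simpa using h1 0
      have h4 := b.sum_repr (f (b 0))
      rw [Fin.sum_univ_two] at h4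
      generalize b.repr (f (b 0)) = c at h2 h4
      rw [h2, zero_smul, zero_add] at h4
      refine ⟨c 1 • 1, ?_, ?_⟩
      · rcases zmod2_cases (c 1) with h | h <;> rw [h] <;> simp
      · have hsq : f * f = c 1 • 1 := by
          refine b.ext fun d => ?_
          fin_cases d
          · change f (f (b 0)) = c 1 • b 0
            rw [← h4, map_smul, h3]
          · change f (f (b 1)) = c 1 • b 1
            rw [h3, ← h4]
        have : (f - c 1 • 1) * (f - c 1 • 1) = 0 := by
          rcases zmod2_cases (c 1) with h | h <;> rw [h] at hsq ⊢
          · simpa using hsq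
          · rw [one_smul] at hsq ⊢
            have h22 : (1 : Module.End (ZMod 2) V) + 1 = 0 := by
              rw [← two_smul (ZMod 2), show (2 : ZMod 2) = 0 from rfl, zero_smul]
            have h2f : f + f = 0 := by
              rw [← two_smul (ZMod 2), show (2 : ZMod 2) = 0 from rfl, zero_smul]
            have : (f - 1) * (f - 1) = f * f + 1 - (f + f) := by noncomm_ring
            rw [this, hsq, h22, h2f, sub_zero]
        rw [show 4 = 2 * 2 from rfl, pow_mul, pow_two (f - _), this]
        simp
    · let a : ℕ → ZMod 2 := fun d => if d = 2 * k + 1 then t - k else if d % 2 = 0 then 0 else 1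
      obtain ⟨b, h1, h2⟩ := aux_basis f _ v hspan hfin a
      rw [Finset.sum_range_succ, sum_pairs a k fun i hi => by
        simp only [a]
        rw [if_neg (by omega), if_neg (by omega), if_neg (by omega), if_pos (by omega), add_zero]]
        at h2
      have h2' : b.repr (f (b 0)) 0 = 0 := by
        have : a (2*k+1) = t - k := by simp [a]
        rw [this, ← ht] at h2
        have := eq_sub_of_add_eq h2
        rw [this]; ring
      refine aux_build f _ a 0 b h1 h2' ?_ ?_ ?_
      · intro i hi h
        simp only [a]; rw [if_neg (by omega), if_neg (by omega), sub_zero]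
      · intro i hi h
        simp only [a]; rw [if_neg (by omega), if_pos (by omega)]
      · intro h
        have hk0 : k = 0 := by omega
        subst hk0
        have : t = 1 := (zmod2_cases t).resolve_left fun h => hk ⟨rfl, h⟩
        simp [a, this]

open Polynomial in
theorem aux_adjoin (p : (ZMod 2)[X]) (hp : p ≠ 0) :
    ∃ e : AddMonoid.End (AdjoinRoot p), e * e = e ∧
      (∀ N : AddMonoid.End (AdjoinRoot p), (∀ x, N x = AdjoinRoot.root p * x - e x) →
        N ^ 4 = 0) := by
  let pb := AdjoinRoot.powerBasis hp
  obtain ⟨e, he, hN⟩ := aux_cyclic (LinearMap.mulLeft (ZMod 2) (AdjoinRoot.root p)) pb.dim 1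
    (by
      rw [← pb.basis.span_eq]
      refine Submodule.span_mono ?_
      rintro _ ⟨i, rfl⟩
      refine ⟨i, ?_⟩
      simp [pb, LinearMap.pow_mulLeft])
    pb.finrank
  refine ⟨e.toAddMonoidHom, ?_, ?_⟩
  · ext x
    exact LinearMap.congr_fun he x
  · intro N h
    have h' : ∀ x, N x = (LinearMap.mulLeft (ZMod 2) (AdjoinRoot.root p) - e) x := by
      intro x; rw [h]; rfl
    ext x
    have : (N ^ 4) x = N (N (N (N x))) := rfl
    rw [this, h', h', h', h']
    have h4 := LinearMap.congr_fun hN x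
    simp only [pow_succ, pow_zero, one_mul, Module.End.mul_apply] at h4
    exact h4

open Polynomial DirectSum in
theorem aux_main {V : Type*} [AddCommGroup V] [Module (ZMod 2) V] [Module.Finite (ZMod 2) V]
    (f : Module.End (ZMod 2) V) :
    ∃ e : Module.End (ZMod 2) V, e * e = e ∧ (f - e) ^ 4 = 0 := by
  classical
  obtain ⟨ι, _, p, hp, k, ⟨φ⟩⟩ := Module.equiv_directSum_of_isTorsion
    (R := (ZMod 2)[X]) (M := Module.AEval' f)
    (Module.AEval.isTorsion_of_finiteDimensional (ZMod 2) V f)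
  have hq : ∀ i, p i ^ k i ≠ 0 := fun i => pow_ne_zero _ (hp i).ne_zero
  choose e he hN using fun i => aux_adjoin (p i ^ k i) (hq i)
  let ψ : V ≃+ ⨁ i, (ZMod 2)[X] ⧸ ((ZMod 2)[X] ∙ p i ^ k i) :=
    (Module.AEval'.of f).toAddEquiv.trans φ.toAddEquiv
  have hψ : ∀ x i, ψ (f x) i = (X : (ZMod 2)[X]) • (ψ x i) := by
    intro x i
    have : Module.AEval'.of f (f x) = (X : (ZMod 2)[X]) • Module.AEval'.of f x :=
      (Module.AEval'.X_smul_of f x).symm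
    change φ (Module.AEval'.of f (f x)) i = _
    rw [this, map_smul]
    rfl
  let E' : (⨁ i, (ZMod 2)[X] ⧸ ((ZMod 2)[X] ∙ p i ^ k i)) →+
      (⨁ i, (ZMod 2)[X] ⧸ ((ZMod 2)[X] ∙ p i ^ k i)) :=
    DFinsupp.mapRange.addMonoidHom (fun i => (e i : AddMonoid.End (AdjoinRoot (p i ^ k i))))
  have hE' : ∀ x i, E' x i = e i (x i) := fun x i => rfl
  let E : V →+ V := (ψ.symm.toAddMonoidHom.comp E').comp ψ.toAddMonoidHom
  have hE : ∀ x i, ψ (E x) i = e i (ψ x i) := by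
    intro x i
    have : ψ (E x) = E' (ψ x) := ψ.apply_symm_apply _
    rw [this, hE']
  refine ⟨E.toZModLinearMap 2, ?_, ?_⟩
  · ext x
    apply ψ.injective
    refine DFinsupp.ext fun i => ?_
    change ψ (E (E x)) i = ψ (E x) i
    rw [hE, hE]
    exact DFunLike.congr_fun (he i) (ψ x i)
  · ext x
    apply ψ.injective
    refine DFinsupp.ext fun i => ?_
    let N : AddMonoid.End (AdjoinRoot (p i ^ k i)) :=
      (show AddMonoid.End (AdjoinRoot (p i ^ k i)) from
        AddMonoidHom.mulLeft (AdjoinRoot.root (p i ^ k i))) - e i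
    have hNx : ∀ y, ψ ((f - E.toZModLinearMap 2) y) i = N (ψ y i) := by
      intro y
      have : (f - E.toZModLinearMap 2) y = f y - E y := rfl
      rw [this, map_sub, DirectSum.sub_apply, hψ, hE]
      have hX : ∀ z : (ZMod 2)[X] ⧸ ((ZMod 2)[X] ∙ p i ^ k i),
          (X : (ZMod 2)[X]) • z = 
            (AdjoinRoot.root (p i ^ k i) * (show AdjoinRoot (p i ^ k i) from z) :
              AdjoinRoot (p i ^ k i)) := by
        intro z
        obtain ⟨z, rfl⟩ := Submodule.Quotient.mk_surjective _ z
        rfl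
      rw [hX]
      rfl
    have h4 := DFunLike.congr_fun (hN i N fun x => rfl) (ψ x i)
    have h5 : ((f - E.toZModLinearMap 2) ^ 4) x = (f - E.toZModLinearMap 2)
      ((f - E.toZModLinearMap 2) ((f - E.toZModLinearMap 2) ((f - E.toZModLinearMap 2) x))) := by
      simp only [pow_succ, pow_zero, one_mul, Module.End.mul_apply]
    rw [h5, hNx, hNx, hNx, hNx, LinearMap.zero_apply, map_zero]
    exact h4

theorem aux_matrix (n : ℕ) (A : Matrix (Fin n) (Fin n) (ZMod 2)) :
    ∃ E U : Matrix (Fin n) (Fin n) (ZMod 2), E * E = E ∧ U ^ 4 = 1 ∧ A = E + U := by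
  obtain ⟨e, he, hN⟩ := aux_main (Matrix.toLinAlgEquiv' A)
  let F := Matrix.toLinAlgEquiv'.symm e
  have hF : F * F = F := by rw [← map_mul, he]
  have hN' : (A - F) ^ 4 = 0 := by
    apply Matrix.toLinAlgEquiv'.injective
    rw [map_pow, map_sub, map_zero]
    simpa [F] using hN
  have h2 : ∀ B : Matrix (Fin n) (Fin n) (ZMod 2), B + B = 0 := by
    intro B
    rw [← two_smul (ZMod 2), show (2 : ZMod 2) = 0 from rfl, zero_smul]
  refine ⟨1 - F, 1 + (A - F), ?_, ?_, ?_⟩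
  · rw [mul_sub, sub_mul, sub_mul, hF]; simp
  · generalize A - F = N at hN'
    have : (1 + N) ^ 4 = 1 + N ^ 4 + ((N + N) + (N + N)) + (N ^ 2 + N ^ 2 + (N ^ 2 + N ^ 2)
      + (N ^ 2 + N ^ 2)) + (N ^ 3 + N ^ 3 + (N ^ 3 + N ^ 3)) := by noncomm_ring
    rw [this]
    simp only [h2, hN', add_zero]
  · have : 1 - F + (1 + (A - F)) = A + (1 + 1) - (F + F) := by abel
    rw [this, h2, h2]; simp

theorem Mn_F2_almost_m_torsion_clean (n : ℕ) (hn : 1 ≤ n) :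
    (∃ m ∈ ({2, 3, 4} : Set ℕ),
        AlmostTorsionClean (Matrix (Fin n) (Fin n) (ZMod 2)) m) ∧
    (∀ A : Matrix (Fin n) (Fin n) (ZMod 2),
        ∃ E U : Matrix (Fin n) (Fin n) (ZMod 2),
          E * E = E ∧ U ^ 4 = 1 ∧ A = E + U) ∧
    AlmostTorsionClean (Matrix (Fin n) (Fin n) (ZMod 2)) 4 := by
  have h : AlmostTorsionClean (Matrix (Fin n) (Fin n) (ZMod 2)) 4 := by
    intro A
    obtain ⟨E, U, hE, hU, hA⟩ := aux_matrix n A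
    exact ⟨U, E, IsUnit.of_pow_eq_one hU (by norm_num), hU, hE, by rw [hA, add_comm]⟩
  exact ⟨⟨4, by simp, h⟩, aux_matrix n, h⟩
end

section
/- If n is a positive integer with n ≡ 4 (mod 8) (i.e., n ∈ 4 + 8ℕ), then the full matrix ring 𝕄ₙ(𝔽₂) is 4-torsion clean. -/
section
set_option linter.unusedSimpArgs false
variable {R : Type*} [Ring R] [Algebra (ZMod 2) R]

theorem sm2 {x y : R} (h : (1 : ZMod 2) • x = (1 : ZMod 2) • y) : x = y := by
  simpa using h

theorem aux_S (u v e : R) (huu : u * u = v) (huv : u * v = 1) (hvu : v * u = 1) (hvv : v * v = u)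
    (hee : e * e = e) (hA : (u + e) ^ 4 = u + e + 1) :
    v*e*u + u*e*v + u*e + e*u + v*e + e*v = 0 := by
  have huu' : ∀ x, u * (u * x) = v * x := fun x => by rw [← mul_assoc, huu]
  have hvv' : ∀ x, v * (v * x) = u * x := fun x => by rw [← mul_assoc, hvv]
  have huv' : ∀ x, u * (v * x) = x := fun x => by rw [← mul_assoc, huv, one_mul]
  have hvu' : ∀ x, v * (u * x) = x := fun x => by rw [← mul_assoc, hvu, one_mul]
  have hee' : ∀ x, e * (e * x) = e * x := fun x => by rw [← mul_assoc, hee]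
  obtain ⟨K, hK⟩ : ∃ K : R, K = 1 + e*u + e*v + u*e + v*e + e*v*e + u*e*u + u*e*v + v*e*u
    + e*u*e*u + u*e*u*e := ⟨_, rfl⟩
  have hK0 : K = 0 := by
    have : K = (u + e) ^ 4 + (u + e + 1) := by
      rw [hK]
      simp only [pow_succ, pow_zero, mul_add, add_mul, mul_assoc, one_mul, mul_one, huu, huv, hvu,
        hvv, hee, huu', hvv', huv', hvu', hee']
      (apply sm2; match_scalars <;> decide)
    rw [this, hA]
    (apply sm2; match_scalars <;> decide)
  have : v*e*u + u*e*v + u*e + e*u + v*e + e*v =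
    (v)*K*(e*u) + (u*e)*K*(v) + (e*v*e)*K*(u) + (1)*K*(e*v*e) + (v)*K*(e*u*e*v)
    + (v)*K*(v*e*v*e) + (e*v*e*u)*K*(1) + (e)*K*(e*v*e) + (v*e*v)*K*(v*e) + (e*v*e*v)*K*(v)
    + (v*e*u*e)*K*(v) + (e*v)*K*(v*e*v) := by
    rw [hK]
    simp only [pow_succ, pow_zero, mul_add, add_mul, mul_assoc, one_mul, mul_one, huu, huv, hvu,
        hvv, hee, huu', hvv', huv', hvu', hee']
    (apply sm2; match_scalars <;> decide)
  rw [this, hK0]; simp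

theorem aux_T (u v e : R) (huu : u * u = v) (huv : u * v = 1) (hvu : v * u = 1) (hvv : v * v = u)
    (hee : e * e = e) (hA : (u + e) ^ 4 = u + e + 1) :
    (u * e + e * u) * (u * e + e * u) = 1 := by
  have huu' : ∀ x, u * (u * x) = v * x := fun x => by rw [← mul_assoc, huu]
  have hvv' : ∀ x, v * (v * x) = u * x := fun x => by rw [← mul_assoc, hvv]
  have huv' : ∀ x, u * (v * x) = x := fun x => by rw [← mul_assoc, huv, one_mul]
  have hvu' : ∀ x, v * (u * x) = x := fun x => by rw [← mul_assoc, hvu, one_mul]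
  have hee' : ∀ x, e * (e * x) = e * x := fun x => by rw [← mul_assoc, hee]
  have hS := aux_S u v e huu huv hvu hvv hee hA
  have : (u * e + e * u) * (u * e + e * u) = 1 + ((u + e) ^ 4 + (u + e + 1)) +
      (v*e*u + u*e*v + u*e + e*u + v*e + e*v) := by
    simp only [pow_succ, pow_zero, mul_add, add_mul, mul_assoc, one_mul, mul_one, huu, huv, hvu,
        hvv, hee, huu', hvv', huv', hvu', hee']
    (apply sm2; match_scalars <;> decide)
  rw [this, hS, hA]
  (apply sm2; match_scalars <;> decide)

theorem aux_d (u v e : R) (huu : u * u = v) (huv : u * v = 1) (hvu : v * u = 1) (hvv : v * v = u)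
    (hee : e * e = e) (hA : (u + e) ^ 4 = u + e + 1) :
    ((u + v) * e * (u + v)) ^ 4 = (u + v) * e * (u + v) + (u + v) := by
  have huu' : ∀ x, u * (u * x) = v * x := fun x => by rw [← mul_assoc, huu]
  have hvv' : ∀ x, v * (v * x) = u * x := fun x => by rw [← mul_assoc, hvv]
  have huv' : ∀ x, u * (v * x) = x := fun x => by rw [← mul_assoc, huv, one_mul]
  have hvu' : ∀ x, v * (u * x) = x := fun x => by rw [← mul_assoc, hvu, one_mul]
  have hee' : ∀ x, e * (e * x) = e * x := fun x => by rw [← mul_assoc, hee]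
  have hS := aux_S u v e huu huv hvu hvv hee hA
  have hT := aux_T u v e huu huv hvu hvv hee hA
  obtain ⟨d, hd⟩ : ∃ d : R, d = (u + v) * e * (u + v) := ⟨_, rfl⟩
  obtain ⟨S, hSS⟩ : ∃ S : R, S = v*e*u + u*e*v + u*e + e*u + v*e + e*v := ⟨_, rfl⟩
  obtain ⟨T, hTT⟩ : ∃ T : R, T = (u * e + e * u) * (u * e + e * u) + 1 := ⟨_, rfl⟩
  have hS0 : S = 0 := by rw [hSS, hS]
  have hT0 : T = 0 := by rw [hTT, hT]; (apply sm2; match_scalars <;> decide)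
  have hdd : d * d = d + 1 + u := by
    have : d * d = d + 1 + u + (u * e * S + u * T * v + u * T + v * e * v * S) := by
      rw [hd, hSS, hTT]
      simp only [pow_succ, pow_zero, mul_add, add_mul, mul_assoc, one_mul, mul_one, huu, huv, hvu,
        hvv, hee, huu', hvv', huv', hvu', hee']
      (apply sm2; match_scalars <;> decide)
    rw [this, hS0, hT0]; simp
  have hdu : u * d = d * u := by
    have : u * d = d * u + S := by
      rw [hd, hSS]
      simp only [pow_succ, pow_zero, mul_add, add_mul, mul_assoc, one_mul, mul_one, huu, huv, hvu,
        hvv, hee, huu', hvv', huv', hvu', hee']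
      (apply sm2; match_scalars <;> decide)
    rw [this, hS0]; simp
  rw [← hd]
  have : d ^ 4 = (d * d) * (d * d) := by noncomm_ring
  rw [this, hdd]
  simp only [mul_add, add_mul, one_mul, mul_one, hdd, hdu, huu]
  (apply sm2; match_scalars <;> decide)

theorem aux_two [Nontrivial R] (u e : R) (huu : u * u = 1) (hee : e * e = e)
    (hA : (u + e) ^ 4 = (u + e) ^ 3 + 1) : False := by
  obtain ⟨A, hAA⟩ : ∃ A : R, A = u + e := ⟨_, rfl⟩
  rw [← hAA] at hA
  have huu' : ∀ x, u * (u * x) = x := fun x => by rw [← mul_assoc, huu, one_mul]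
  have hee' : ∀ x, e * (e * x) = e * x := fun x => by rw [← mul_assoc, hee]
  obtain ⟨C, hC⟩ : ∃ C : R, C = A * A + A := ⟨_, rfl⟩
  have hAC : A * A * C = 1 := by
    have : A * A * C = A ^ 4 + A ^ 3 := by rw [hC]; noncomm_ring
    rw [this, hA]; (apply sm2; match_scalars <;> decide)
  have hCA : C * (A * A) = 1 := by
    have : C * (A * A) = A ^ 4 + A ^ 3 := by rw [hC]; noncomm_ring
    rw [this, hA]; (apply sm2; match_scalars <;> decide)
  have hCC : C * C = A * C + 1 := by
    have : C * C = A * C + (A ^ 4 + A ^ 3) := by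
      rw [hC]; simp only [pow_succ, pow_zero, mul_add, add_mul, mul_assoc, one_mul]
      (apply sm2; match_scalars <;> decide)
    rw [this, hA]; (apply sm2; match_scalars <;> decide)
  have huC : u * C = C * u := by
    rw [hC, hAA]
    simp only [mul_add, add_mul, mul_assoc, one_mul, mul_one, huu, huu', hee, hee']
    (apply sm2; match_scalars <;> decide)
  have h1 : u * (A * C) = A * C * u := by
    have h : A * C = C * C + 1 := by rw [hCC]; (apply sm2; match_scalars <;> decide)
    rw [h, mul_add, add_mul, ← mul_assoc, huC, mul_assoc, huC, ← mul_assoc]; simp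
  have h2 : u * A = A * u := by
    have : u * A * C = A * u * C := by rw [mul_assoc, h1, mul_assoc, ← huC, ← mul_assoc]
    calc u * A = u * A * C * (A * A) := by rw [mul_assoc (u * A), hCA, mul_one]
      _ = A * u := by rw [this, mul_assoc (A * u), hCA, mul_one]
  have h3 : u * e = e * u := by
    rw [hAA, mul_add, add_mul] at h2
    exact add_left_cancel h2
  have hC0 : C * C = 0 := by
    have : C = 1 + u := by
      rw [hC, hAA]
      simp only [mul_add, add_mul, huu, hee, h3]
      (apply sm2; match_scalars <;> decide)
    rw [this]
    simp only [mul_add, add_mul, huu, one_mul, mul_one]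
    (apply sm2; match_scalars <;> decide)
  have : (1 : R) = A * A * (C * C) * (A * A) := by
    rw [← mul_assoc (A * A), hAC, one_mul, hCA]
  rw [hC0] at this
  simp at this
theorem aux_TP (u v e : R) (huu : u * u = v) (huv : u * v = 1) (hvu : v * u = 1) (hvv : v * v = u)
    (hee : e * e = e) (hA : (u + e) ^ 4 = u + e + 1) :
    (u * e + e * u) * (u + v) = (1 + (u + v)) * (u * e + e * u) := by
  have two : ∀ x : R, x + x = 0 := fun x => by
    rw [← two_smul (ZMod 2) x, show (2 : ZMod 2) = 0 from rfl, zero_smul]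
  have hS := aux_S u v e huu huv hvu hvv hee hA
  have key : (u * e + e * u) * (u + v) + (1 + (u + v)) * (u * e + e * u) = 0 := by
    have h1 : (u * e + e * u) * (u + v) + (1 + (u + v)) * (u * e + e * u)
        + ((v * e + e * v) + (v * e + e * v)) =
      (v*e*u + u*e*v + u*e + e*u + v*e + e*v) + (u*e*u + u*e*u) +
        (e * (u * u) + (u * u) * e + (e * (u * v) + (v * u) * e) + (e * v + v * e)) := by
      noncomm_ring
    rw [two, add_zero, hS, two, huu, huv, hvu, mul_one, one_mul, two e, add_zero, add_zero,
      two, add_zero] at h1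
    exact h1
  calc _ = (u * e + e * u) * (u + v) + ((1 + (u + v)) * (u * e + e * u)
        + (1 + (u + v)) * (u * e + e * u)) := by rw [two, add_zero]
    _ = _ := by rw [← add_assoc, key, zero_add]

end

theorem cyc_dec {V : Type*} [AddCommGroup V] [Module (ZMod 2) V] (n : ℕ)
    (b : Module.Basis (Fin (n + 1)) (ZMod 2) V) (β : ℕ → V) (hb : ∀ i : Fin (n + 1), b i = β i)
    (A : V →ₗ[ZMod 2] V)
    (hA : ∀ i < n, A (β i) = β (i + 1) + if (n - i) % 2 = 0 then β i else 0) :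
    ∃ E N : V →ₗ[ZMod 2] V, (∀ m, E (E m) = E m) ∧ (∀ m, N (N (N (N m))) = 0) ∧
      ∀ m, A m = E m + N m := by
  have two : ∀ x : V, x + x = 0 := fun x => by
    have : (2 : ZMod 2) • x = 0 := by rw [show (2 : ZMod 2) = 0 from rfl, zero_smul]
    rwa [two_smul] at this
  have ext : ∀ f g : V →ₗ[ZMod 2] V, (∀ i ≤ n, f (β i) = g (β i)) → ∀ m, f m = g m := by
    intro f g h m
    have : f = g := b.ext fun i => by rw [hb]; exact h i (by omega)
    rw [this]
  set E0 : V →ₗ[ZMod 2] V := b.constr (ZMod 2) fun i =>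
    if (i : ℕ) < n ∧ (n - i) % 2 = 0 then β i + β (i + 1) else 0 with hE0
  set N0 : V →ₗ[ZMod 2] V := b.constr (ZMod 2) fun i =>
    if (i : ℕ) < n ∧ (n - i) % 2 = 1 then β (i + 1) else 0 with hN0
  set φ : V →ₗ[ZMod 2] ZMod 2 := b.constr (ZMod 2) fun i => if (i : ℕ) = n then 1 else 0 with hφ
  have E0b : ∀ i ≤ n, E0 (β i) = if i < n ∧ (n - i) % 2 = 0 then β i + β (i + 1) else 0 := by
    intro i hi
    have := b.constr_basis (ZMod 2) (fun i : Fin (n + 1) =>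
      if (i : ℕ) < n ∧ (n - i) % 2 = 0 then β i + β (i + 1) else 0) ⟨i, by omega⟩
    rwa [hb] at this
  have N0b : ∀ i ≤ n, N0 (β i) = if i < n ∧ (n - i) % 2 = 1 then β (i + 1) else 0 := by
    intro i hi
    have := b.constr_basis (ZMod 2) (fun i : Fin (n + 1) =>
      if (i : ℕ) < n ∧ (n - i) % 2 = 1 then β (i + 1) else 0) ⟨i, by omega⟩
    rwa [hb] at this
  have φb : ∀ i ≤ n, φ (β i) = if i = n then 1 else 0 := by
    intro i hi
    have := b.constr_basis (ZMod 2) (fun i : Fin (n + 1) =>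
      if (i : ℕ) = n then (1 : ZMod 2) else 0) ⟨i, by omega⟩
    rwa [hb] at this
  clear_value E0 N0 φ
  have E0E0 : ∀ m, E0 (E0 m) = E0 m := by
    refine ext (E0 ∘ₗ E0) E0 fun i hi => ?_
    rw [LinearMap.comp_apply, E0b i hi]
    split_ifs with h
    · rw [map_add, E0b i hi, E0b (i + 1) (by omega), if_pos h, if_neg (by omega), add_zero]
    · simp
  have N0N0 : ∀ m, N0 (N0 m) = 0 := by
    refine ext (N0 ∘ₗ N0) 0 fun i hi => ?_
    rw [LinearMap.comp_apply, N0b i hi]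
    split_ifs with h
    · rw [N0b (i + 1) (by omega), if_neg (by omega)]; simp
    · simp
  have φE0 : ∀ m, φ (E0 m) = 0 := by
    intro m
    have : φ ∘ₗ E0 = 0 := b.ext fun i => by
      rw [hb, LinearMap.comp_apply, E0b i (by omega)]
      split_ifs with h
      · rw [map_add, φb i (by omega), φb (i + 1) (by omega), if_neg (by omega),
          if_neg (by omega)]; simp
      · simp
    exact LinearMap.congr_fun this m
  have hlow : ∀ x, φ x = 0 → x ∈ Submodule.span (ZMod 2) {y | ∃ i < n, y = β i} := by
    intro x hx
    have h1 := b.sum_repr x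
    rw [Fin.sum_univ_castSucc] at h1
    have h2 : (∑ i : Fin n, b.repr x i.castSucc • b i.castSucc) ∈
        Submodule.span (ZMod 2) {y | ∃ i < n, y = β i} := by
      refine Submodule.sum_mem _ fun i _ => Submodule.smul_mem _ _ (Submodule.subset_span ?_)
      exact ⟨i, i.2, by rw [hb]; rfl⟩
    have h3 : φ (∑ i : Fin n, b.repr x i.castSucc • b i.castSucc) = 0 := by
      rw [map_sum]
      refine Finset.sum_eq_zero fun i _ => ?_
      rw [map_smul, hb, φb _ (by simp), if_neg (by simp; omega)]; simp
    have h4 : b.repr x (Fin.last n) = 0 := by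
      rw [← h1, map_add, h3, map_smul, hb, φb _ (by simp), if_pos (by simp)] at hx
      simpa using hx
    rw [h4, zero_smul, add_zero] at h1
    rw [← h1]; exact h2
  have key : ∀ c' c'' : V, A (β n) = c' + c'' → ((E0 c' = c' ∧ φ c' = 0) ∨ (E0 c' = 0 ∧ φ c' = 1)) →
      φ c'' = 0 → φ (N0 c'') = 0 → ∃ E N : V →ₗ[ZMod 2] V, (∀ m, E (E m) = E m) ∧
      (∀ m, N (N (N (N m))) = 0) ∧ ∀ m, A m = E m + N m := by
    intro c' c'' hc hE h1 h2
    refine ⟨E0 + φ.smulRight c', N0 + φ.smulRight c'', fun m => ?_, fun m => ?_, ?_⟩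
    · simp only [LinearMap.add_apply, LinearMap.smulRight_apply, map_add, map_smul, E0E0, φE0]
      rcases hE with ⟨h3, h4⟩ | ⟨h3, h4⟩
      · simp [h3, h4]
      · simp [h3, h4]
    · simp only [LinearMap.add_apply, LinearMap.smulRight_apply, map_add, map_smul, N0N0, h1, h2]
      simp
    · refine ext A (E0 + φ.smulRight c' + (N0 + φ.smulRight c'')) fun i hi => ?_
      simp only [LinearMap.add_apply, LinearMap.smulRight_apply, E0b i hi, N0b i hi, φb i hi]
      by_cases h : i = n
      · subst h; simp [hc]
      · rw [hA i (by omega)]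
        rcases Nat.mod_two_eq_zero_or_one (n - i) with h5 | h5
        · simp [h5, h, show i < n by omega]; abel
        · simp [h5, h, show i < n by omega]
  have z2 : ∀ z : ZMod 2, z = 0 ∨ z = 1 := by decide
  rcases z2 (φ (A (β n))) with h0 | h0
  · by_cases hn : n = 1
    · subst hn
      have hmem := hlow _ h0
      have hA0 := hA 0 (by omega)
      simp at hA0
      have : {y | ∃ i < 1, y = β i} = {β 0} := by
        ext y; simp
      rw [this, Submodule.mem_span_singleton] at hmem
      obtain ⟨a, ha⟩ := hmem
      have hAA : ∀ m, A (A m) = a • m := by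
        refine ext (A ∘ₗ A) (a • LinearMap.id) fun i hi => ?_
        interval_cases i
        · simp [hA0, ha]
        · simp [← ha, hA0]
      rcases z2 a with h | h
      · subst h
        exact ⟨0, A, by simp, by simp [hAA], by simp⟩
      · subst h
        refine ⟨LinearMap.id, A + LinearMap.id, by simp, fun m => ?_, fun m => ?_⟩
        · have : (A + LinearMap.id : V →ₗ[ZMod 2] V) ((A + LinearMap.id : V →ₗ[ZMod 2] V) m) = 0 := by
            simp [hAA]
            rw [show m + A m + (A m + m) = (m + m) + (A m + A m) by abel, two, two, add_zero]
          rw [this]; simp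
        · simp
          rw [show m + (A m + m) = (m + m) + A m by abel, two, zero_add]
    · have : Submodule.span (ZMod 2) {y | ∃ i < n, y = β i} ≤
          (LinearMap.ker (E0 - LinearMap.id) ⊓ LinearMap.ker φ) ⊔
            (LinearMap.ker φ ⊓ LinearMap.ker (φ ∘ₗ N0)) := by
        rw [Submodule.span_le]
        rintro _ ⟨i, hi, rfl⟩
        by_cases hy : (n - i) % 2 = 1 ∧ i ≠ 0
        · obtain ⟨j, rfl⟩ : ∃ j, i = j + 1 := ⟨i - 1, by omega⟩
          have : β (j + 1) = (β j + β (j + 1)) + β j := by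
            rw [add_right_comm, two, zero_add]
          rw [this]
          refine Submodule.add_mem_sup ⟨?_, ?_⟩ ⟨?_, ?_⟩
          · simp [E0b j (by omega), E0b (j + 1) (by omega), sub_eq_zero]
            rw [if_pos (by omega), if_neg (by omega), add_zero]
          · simp [φb j (by omega), φb (j + 1) (by omega)]
            rw [if_neg (by omega), if_neg (by omega), add_zero]
          · simp [φb j (by omega)]; omega
          · simp [N0b j (by omega)]
            rw [if_neg (by omega), map_zero]
        · refine Submodule.mem_sup_right ⟨?_, ?_⟩
          · simp [φb i (by omega)]; omega
          · simp [N0b i (by omega)]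
            split_ifs with h
            · rw [φb _ (by omega), if_neg (by omega)]
            · simp
      obtain ⟨c', hc', c'', hc'', h⟩ := Submodule.mem_sup.1 (this (hlow _ h0))
      refine key c' c'' h.symm (Or.inl ⟨?_, hc'.2⟩) hc''.1 hc''.2
      have := hc'.1
      simpa [sub_eq_zero] using this
  · have : Submodule.span (ZMod 2) {y | ∃ i < n, y = β i} ≤
          (LinearMap.ker E0 ⊓ LinearMap.ker φ) ⊔
            (LinearMap.ker φ ⊓ LinearMap.ker (φ ∘ₗ N0)) := by
      rw [Submodule.span_le]
      rintro _ ⟨i, hi, rfl⟩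
      by_cases hy : (n - i) % 2 = 1
      · refine Submodule.mem_sup_left ⟨?_, ?_⟩
        · simp [E0b i (by omega)]; omega
        · simp [φb i (by omega)]; omega
      · refine Submodule.mem_sup_right ⟨?_, ?_⟩
        · simp [φb i (by omega)]; omega
        · simp [N0b i (by omega), hy]
    have h1 : φ (A (β n) + β n) = 0 := by
      rw [map_add, h0, φb n le_rfl, if_pos rfl]; rfl
    obtain ⟨c', hc', c'', hc'', h⟩ := Submodule.mem_sup.1 (this (hlow _ h1))
    refine key (c' + β n) c'' ?_ (Or.inr ⟨?_, ?_⟩) hc''.1 hc''.2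
    · rw [add_right_comm, h, add_assoc, two, add_zero]
    · have : E0 c' = 0 := hc'.1
      rw [map_add, this, E0b n le_rfl]; simp
    · have : φ c' = 0 := hc'.2
      rw [map_add, this, φb n le_rfl]; simp

section
open Polynomial

def GoodMod (M : Type*) [AddCommGroup M] [Module (ZMod 2)[X] M] : Prop :=
  ∃ E N : M →+ M, (∀ m, E (E m) = E m) ∧ (∀ m, N (N (N (N m))) = 0) ∧
    ∀ m, (X : (ZMod 2)[X]) • m = E m + N m

theorem GoodMod.of_equiv {M M' : Type*} [AddCommGroup M] [Module (ZMod 2)[X] M]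
    [AddCommGroup M'] [Module (ZMod 2)[X] M'] (f : M ≃ₗ[(ZMod 2)[X]] M') (h : GoodMod M') :
    GoodMod M := by
  obtain ⟨E, N, h1, h2, h3⟩ := h
  refine ⟨(f.symm : M' →+ M).comp (E.comp (f : M →+ M')),
    (f.symm : M' →+ M).comp (N.comp (f : M →+ M')), ?_, ?_, ?_⟩
  · intro m; simp [h1]
  · intro m; simp [h2]
  · intro m
    apply f.injective
    simp [h3]

theorem GoodMod.pi {ι : Type*} (M : ι → Type*) [∀ i, AddCommGroup (M i)]
    [∀ i, Module (ZMod 2)[X] (M i)] (h : ∀ i, GoodMod (M i)) : GoodMod (∀ i, M i) := by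
  choose E N h1 h2 h3 using h
  refine ⟨AddMonoidHom.mk' (fun f i => E i (f i)) ?_, AddMonoidHom.mk' (fun f i => N i (f i)) ?_,
    ?_, ?_, ?_⟩
  · intro f g; ext i; simp
  · intro f g; ext i; simp
  · intro m; ext i; simp [h1]
  · intro m; ext i; simp [h2]
  · intro m; ext i; simp [h3]

theorem GoodMod.cyclic (q : (ZMod 2)[X]) (hq : q ≠ 0) :
    GoodMod ((ZMod 2)[X] ⧸ Ideal.span {q}) := by
  have hfin : Module.finrank (ZMod 2) ((ZMod 2)[X] ⧸ Ideal.span {q}) = q.natDegree :=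
    finrank_quotient_span_eq_natDegree
  have two : ∀ x : ((ZMod 2)[X] ⧸ Ideal.span {q}), x + x = 0 := fun x => by
    have : (2 : ZMod 2) • x = 0 := by rw [show (2 : ZMod 2) = 0 from rfl, zero_smul]
    rwa [two_smul] at this
  have hpow : ∀ x : ((ZMod 2)[X] ⧸ Ideal.span {q}), x ∈ Submodule.span (ZMod 2)
      {y | ∃ j < q.natDegree, y = Ideal.Quotient.mk (Ideal.span {q}) (X ^ j)} := by
    intro x
    obtain ⟨f, rfl⟩ := Ideal.Quotient.mk_surjective x
    have hmod : Ideal.Quotient.mk (Ideal.span {q}) f = Ideal.Quotient.mk (Ideal.span {q}) (f % q) := by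
      rw [Ideal.Quotient.eq, Ideal.mem_span_singleton]
      exact ⟨f / q, by rw [sub_eq_iff_eq_add, EuclideanDomain.div_add_mod]⟩
    rw [hmod, (f % q).as_sum_support_C_mul_X_pow, map_sum]
    refine Submodule.sum_mem _ fun i hi => ?_
    have hlt : i < q.natDegree := by
      have h1 := le_degree_of_mem_supp i hi
      have h2 := degree_mod_lt f hq
      rw [degree_eq_natDegree hq] at h2
      exact_mod_cast h1.trans_lt h2
    have : Ideal.Quotient.mk (Ideal.span {q}) (C ((f % q).coeff i) * X ^ i) =
        (f % q).coeff i • Ideal.Quotient.mk (Ideal.span {q}) (X ^ i) := by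
      rw [← smul_eq_C_mul]; rfl
    rw [this]
    exact Submodule.smul_mem _ _ (Submodule.subset_span ⟨i, hlt, rfl⟩)
  rcases hd : q.natDegree with _ | n
  · refine ⟨0, 0, by simp, by simp, fun m => ?_⟩
    have := hpow ((X : (ZMod 2)[X]) • m)
    simp [hd] at this
    simp [this]
  rw [hd] at hfin hpow
  let β : ℕ → ((ZMod 2)[X] ⧸ Ideal.span {q}) := fun i => Nat.rec (Ideal.Quotient.mk _ 1)
    (fun i b => (X : (ZMod 2)[X]) • b + if (n - i) % 2 = 0 then b else 0) i
  have hβ : ∀ i, β (i + 1) = (X : (ZMod 2)[X]) • β i + if (n - i) % 2 = 0 then β i else 0 :=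
    fun i => rfl
  have hβ0 : β 0 = Ideal.Quotient.mk _ 1 := rfl
  clear_value β
  let A : ((ZMod 2)[X] ⧸ Ideal.span {q}) →ₗ[ZMod 2] ((ZMod 2)[X] ⧸ Ideal.span {q}) :=
    (AddMonoidHom.mk' (fun m => (X : (ZMod 2)[X]) • m) (fun a b => smul_add _ a b)).toZModLinearMap 2
  have hA : ∀ m, A m = (X : (ZMod 2)[X]) • m := fun m => rfl
  clear_value A
  have hAβ : ∀ i, A (β i) = β (i + 1) + if (n - i) % 2 = 0 then β i else 0 := by
    intro i
    rw [hβ, hA, add_assoc, two, add_zero]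
  have hspan : ∀ j, Ideal.Quotient.mk (Ideal.span {q}) (X ^ j) ∈
      Submodule.span (ZMod 2) {y | ∃ i ≤ j, y = β i} := by
    intro j
    induction j with
    | zero => exact Submodule.subset_span ⟨0, le_rfl, by simp [hβ0]⟩
    | succ j ih =>
      have h1 : Ideal.Quotient.mk (Ideal.span {q}) (X ^ (j + 1)) =
        A (Ideal.Quotient.mk (Ideal.span {q}) (X ^ j)) := by
        rw [hA, pow_succ']; rfl
      have h2 : Submodule.span (ZMod 2) {y | ∃ i ≤ j, y = β i} ≤
          (Submodule.span (ZMod 2) {y | ∃ i ≤ j + 1, y = β i}).comap A := by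
        rw [Submodule.span_le]
        rintro _ ⟨i, hi, rfl⟩
        simp only [Submodule.comap_coe, Set.mem_preimage, SetLike.mem_coe, hAβ]
        refine Submodule.add_mem _ (Submodule.subset_span ⟨i + 1, by omega, rfl⟩) ?_
        split_ifs
        · exact Submodule.subset_span ⟨i, by omega, rfl⟩
        · exact Submodule.zero_mem _
      rw [h1]
      exact h2 ih
  have htop : ⊤ ≤ Submodule.span (ZMod 2) (Set.range fun i : Fin (n + 1) => β i) := by
    intro x _
    refine (Submodule.span_le.2 ?_) (hpow x)
    rintro _ ⟨j, hj, rfl⟩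
    refine Submodule.span_mono ?_ (hspan j)
    rintro _ ⟨i, hi, rfl⟩
    exact ⟨⟨i, by omega⟩, rfl⟩
  let b := basisOfTopLeSpanOfCardEqFinrank (fun i : Fin (n + 1) => β i) htop (by simp [hfin])
  have hb : ∀ i : Fin (n + 1), b i = β i := fun i => by
    simp [b]
  obtain ⟨E, N, h1, h2, h3⟩ := cyc_dec n b β hb A (fun i _ => hAβ i)
  exact ⟨E.toAddMonoidHom, N.toAddMonoidHom, h1, h2, fun m => by rw [← hA]; exact h3 m⟩

theorem exists_dec (n : ℕ) (r : Matrix (Fin n) (Fin n) (ZMod 2)) :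
    ∃ E N : Matrix (Fin n) (Fin n) (ZMod 2), E * E = E ∧ N ^ 4 = 0 ∧ r = E + N := by
  let a := Matrix.toLin' r
  have htors : Module.IsTorsion (ZMod 2)[X] (Module.AEval' a) :=
    Module.AEval.isTorsion_of_finiteDimensional (ZMod 2) (Fin n → ZMod 2) a
  obtain ⟨ι, _, p, hp, e, ⟨f⟩⟩ := Module.equiv_directSum_of_isTorsion htors
  have hgood : GoodMod (Module.AEval' a) := by
    classical
    refine GoodMod.of_equiv (f.trans (DirectSum.linearEquivFunOnFintype _ _ _)) ?_
    exact GoodMod.pi _ fun i => GoodMod.cyclic _ (pow_ne_zero _ (hp i).ne_zero)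
  obtain ⟨E, N, h1, h2, h3⟩ := hgood
  let o := Module.AEval'.of a
  let E' : (Fin n → ZMod 2) →ₗ[ZMod 2] (Fin n → ZMod 2) :=
    ((o.symm : _ →+ (Fin n → ZMod 2)).comp (E.comp (o : (Fin n → ZMod 2) →+ _))).toZModLinearMap 2
  let N' : (Fin n → ZMod 2) →ₗ[ZMod 2] (Fin n → ZMod 2) :=
    ((o.symm : _ →+ (Fin n → ZMod 2)).comp (N.comp (o : (Fin n → ZMod 2) →+ _))).toZModLinearMap 2
  have hE' : ∀ m, E' m = o.symm (E (o m)) := fun m => rfl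
  have hN' : ∀ m, N' m = o.symm (N (o m)) := fun m => rfl
  clear_value E' N'
  refine ⟨LinearMap.toMatrix' E', LinearMap.toMatrix' N', ?_, ?_, ?_⟩
  · rw [← LinearMap.toMatrix'_mul]
    congr 1
    refine LinearMap.ext fun m => ?_
    simp [hE', h1]
  · apply Matrix.toLin'.injective
    rw [Matrix.toLin'_pow]
    refine LinearMap.ext fun m => ?_
    simp [pow_succ, hN', h2]
  · apply Matrix.toLin'.injective
    refine LinearMap.ext fun m => ?_
    have := h3 (o m)
    rw [Module.AEval'.X_smul_of] at this
    have h4 := congrArg o.symm this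
    simp only [o, LinearEquiv.symm_apply_apply] at h4
    rw [map_add]
    simp [hE', hN', o]
    simpa [a] using h4

end

theorem count_aux (n : ℕ) (P T e : Matrix (Fin n) (Fin n) (ZMod 2)) (hP : P * P = P)
    (hT : T * T = 1) (hTP : T * P = (1 + P) * T)
    (hd : (P * e * P) ^ 4 = P * e * P + P) : n % 8 ≠ 4 := by
  intro hn
  have two : ∀ x : Fin n → ZMod 2, x + x = 0 := fun x => by
    ext i; exact CharTwo.add_self_eq_zero _
  let F0 := {x : Fin n → ZMod 2 // P.mulVec x = x}
  let F1 := {x : Fin n → ZMod 2 // P.mulVec x = 0}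
  have hTT : ∀ x, T.mulVec (T.mulVec x) = x := fun x => by
    rw [Matrix.mulVec_mulVec, hT, Matrix.one_mulVec]
  have hPP : ∀ x, P.mulVec (P.mulVec x) = P.mulVec x := fun x => by
    rw [Matrix.mulVec_mulVec, hP]
  have hTP' : ∀ x, T.mulVec (P.mulVec x) = T.mulVec x + P.mulVec (T.mulVec x) := fun x => by
    rw [Matrix.mulVec_mulVec, hTP, add_mul, one_mul, Matrix.add_mulVec, Matrix.mulVec_mulVec]
  have hPT : ∀ x, P.mulVec (T.mulVec x) = T.mulVec x + T.mulVec (P.mulVec x) := fun x => by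
    rw [hTP', ← add_assoc, two, zero_add]
  let e1 : F0 ≃ F1 :=
    { toFun := fun x => ⟨T.mulVec x.1, by rw [hPT, x.2, two]⟩
      invFun := fun x => ⟨T.mulVec x.1, by rw [hPT, x.2]; simp⟩
      left_inv := fun x => Subtype.ext (hTT _)
      right_inv := fun x => Subtype.ext (hTT _) }
  let e2 : (Fin n → ZMod 2) ≃ F0 × F1 :=
    { toFun := fun x => (⟨P.mulVec x, hPP x⟩, ⟨x + P.mulVec x, by
        rw [Matrix.mulVec_add, hPP, two]⟩)
      invFun := fun x => x.1.1 + x.2.1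
      left_inv := fun x => by
        change P.mulVec x + (x + P.mulVec x) = x
        rw [add_left_comm, two, add_zero]
      right_inv := fun x => by
        obtain ⟨⟨x, hx⟩, ⟨y, hy⟩⟩ := x
        refine Prod.ext (Subtype.ext ?_) (Subtype.ext ?_)
        · simp [Matrix.mulVec_add, hx, hy]
        · simp only [Matrix.mulVec_add, hx, hy]
          rw [add_zero, add_right_comm, two, zero_add] }
  have hcard : 2 ^ n = Fintype.card F0 * Fintype.card F0 := by
    have h := Fintype.card_congr e2
    rw [Fintype.card_prod, ← Fintype.card_congr e1] at h
    simpa using h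
  obtain ⟨k, rfl⟩ : ∃ k, n = 8 * k + 4 := ⟨n / 8, by omega⟩
  have hc : Fintype.card F0 = 2 ^ (4 * k + 2) := by
    apply Nat.mul_self_inj.1
    rw [← hcard, ← pow_add]; congr 1; omega
  let f : F0 → F0 := fun x => ⟨P.mulVec (e.mulVec x.1), hPP _⟩
  have hf : ∀ x, (f x).1 = (P * e * P).mulVec x.1 := fun x => by
    conv_rhs => rw [← Matrix.mulVec_mulVec, x.2, ← Matrix.mulVec_mulVec]
  have hf4 : ∀ x, (f (f (f (f x)))).1 = (f x).1 + x.1 := fun x => by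
    simp only [hf, Matrix.mulVec_mulVec]
    have : P * e * P * (P * e * P * (P * e * P * (P * e * P))) = (P * e * P) ^ 4 := by
      simp only [pow_succ, pow_zero, one_mul, mul_assoc]
    rw [this, hd, Matrix.add_mulVec, x.2]
  have hadd : ∀ x y z : F0, x.1 = y.1 + z.1 → (f x).1 = (f y).1 + (f z).1 := fun x y z h => by
    rw [hf, hf, hf, h, Matrix.mulVec_add]
  have h5 : ∀ x, (f (f (f (f (f x))))).1 = (f (f x)).1 + (f x).1 := fun x => hadd _ _ _ (hf4 x)
  have h6 : ∀ x, (f (f (f (f (f (f x)))))).1 = (f (f (f x))).1 + (f (f x)).1 :=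
    fun x => hadd _ _ _ (h5 x)
  have h7 : ∀ x, (f^[7] x).1 = (f x).1 + x.1 + (f (f (f x))).1 := fun x => by
    have h := hadd _ _ _ (h6 x)
    exact h.trans (congrArg (fun w => w + (f (f (f x))).1) (hf4 x))
  have h8 : ∀ x, (f^[8] x).1 = x.1 + (f (f x)).1 := fun x => by
    have a : (f^[8] x).1 = (f (f^[7] x)).1 := by
      rw [Function.iterate_succ_apply' f 7 x]
    rw [a, hf, h7, Matrix.mulVec_add, Matrix.mulVec_add, ← hf, ← hf, ← hf, hf4,
      show (f (f x)).1 + (f x).1 + ((f x).1 + x.1) = (f (f x)).1 + ((f x).1 + (f x).1) + x.1 by abel,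
      two, add_zero]
    exact add_comm _ _
  have h15 : ∀ x, f^[15] x = x := fun x => Subtype.ext <| by
    have a : (f^[15] x).1 = (f^[7] (f^[8] x)).1 := by rw [← Function.iterate_add_apply]
    have b : ∀ j : ℕ, ∀ x y z : F0, x.1 = y.1 + z.1 → (f^[j] x).1 = (f^[j] y).1 + (f^[j] z).1 := by
      intro j
      induction j with
      | zero => exact fun x y z h => h
      | succ j ih => exact fun x y z h => ih _ _ _ (hadd _ _ _ h)
    rw [a, b 7 _ _ _ (h8 x), h7, h7, h5]
    have : (f (f (f x))).1 + (f (f x)).1 + ((f (f x)).1 + (f x).1) = (f (f (f x))).1 + (f x).1 := by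
      rw [show (f (f (f x))).1 + (f (f x)).1 + ((f (f x)).1 + (f x).1) =
        (f (f (f x))).1 + ((f (f x)).1 + (f (f x)).1) + (f x).1 by abel, two, add_zero]
    rw [this, show (f x).1 + x.1 + (f (f (f x))).1 + ((f (f (f x))).1 + (f x).1) =
      x.1 + ((f x).1 + (f x).1) + ((f (f (f x))).1 + (f (f (f x))).1) by abel, two, two, add_zero,
      add_zero]
  let g : Function.End F0 := f^[3]
  have hg : g ^ 5 ^ 1 = 1 := by
    funext x
    exact h15 x
  have : Fact (Nat.Prime 5) := ⟨by norm_num⟩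
  have hmod := Equiv.Perm.card_fixedPoints_modEq hg
  have hfix : Fintype.card (Function.fixedPoints g) = 1 := by
    rw [Fintype.card_eq_one_iff]
    have h00 : f (⟨0, by simp⟩ : F0) = ⟨0, by simp⟩ := Subtype.ext (by rw [hf]; simp)
    refine ⟨⟨⟨0, by simp⟩, ?_⟩, ?_⟩
    · change f (f (f _)) = _
      rw [h00, h00, h00]
    · rintro ⟨x, hx⟩
      apply Subtype.ext
      apply Subtype.ext
      have hx' : f (f (f x)) = x := hx
      have := hf4 x
      rw [hx'] at this
      simpa using this
  rw [hfix, hc] at hmod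
  have : 2 ^ (4 * k + 2) ≡ 4 [MOD 5] := by
    rw [pow_add, pow_mul]
    have h1 : (2 ^ 4) ^ k ≡ 1 ^ k [MOD 5] := Nat.ModEq.pow k (by decide)
    have := h1.mul_right (2 ^ 2)
    simpa using this
  have := this.symm.trans hmod
  exact absurd this (by decide)

def phiHom (n m : ℕ) (h : n = 4 * m) :
    Matrix (Fin 4) (Fin 4) (ZMod 2) →+* Matrix (Fin n) (Fin n) (ZMod 2) :=
  ((Matrix.reindexRingEquiv (ZMod 2) (finProdFinEquiv.trans (finCongr h.symm))).toRingHom.comp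
    (Matrix.blockDiagonalRingHom (Fin 4) (Fin m) (ZMod 2))).comp (Pi.constRingHom (Fin m) _)

theorem exA (n m : ℕ) (h : n = 4 * m) :
    ∃ A : Matrix (Fin n) (Fin n) (ZMod 2), A ^ 4 = A + 1 := by
  let B : Matrix (Fin 4) (Fin 4) (ZMod 2) := !![0,0,0,1;1,0,0,1;0,1,0,0;0,0,1,0]
  have hB : B ^ 4 = B + 1 := by decide +kernel
  refine ⟨phiHom n m h B, ?_⟩
  rw [← map_pow, hB, map_add, map_one]

theorem exA' (n m : ℕ) (h : n = 4 * m) :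
    ∃ A : Matrix (Fin n) (Fin n) (ZMod 2), A ^ 4 = A ^ 3 + 1 := by
  let B : Matrix (Fin 4) (Fin 4) (ZMod 2) := !![0,0,0,1;1,0,0,0;0,1,0,0;0,0,1,1]
  have hB : B ^ 4 = B ^ 3 + 1 := by decide +kernel
  refine ⟨phiHom n m h B, ?_⟩
  rw [← map_pow, hB, map_add, map_one, map_pow]

theorem Mn_F2_four_torsion_clean (n : ℕ) (hn : n % 8 = 4) :
    TorsionClean (Matrix (Fin n) (Fin n) (ZMod 2)) 4 := by
  have two : ∀ x : Matrix (Fin n) (Fin n) (ZMod 2), x + x = 0 := fun x => by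
    ext i j
    exact CharTwo.add_self_eq_zero _
  have : Nonempty (Fin n) := ⟨⟨0, by omega⟩⟩
  obtain ⟨m, hm⟩ : ∃ m, n = 4 * m := ⟨n / 4, by omega⟩
  have hno : ∀ u e : Matrix (Fin n) (Fin n) (ZMod 2), u * u = 1 → e * e = e →
      (u + e) ^ 4 = (u + e) ^ 3 + 1 → False := fun u e h1 h2 h3 => aux_two u e h1 h2 h3
  refine ⟨?_, ?_⟩
  · intro r
    obtain ⟨E, N, hE, hN, hr⟩ := exists_dec n r
    have hu : (1 + N) ^ 4 = 1 := by
      have h2 : (1 + N) * (1 + N) = 1 + N * N := by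
        rw [add_mul, mul_add, mul_add, one_mul, one_mul, mul_one,
          show 1 + N + (N + N * N) = 1 + (N + N) + N * N by abel, two, add_zero]
      have h4 : (1 + N * N) * (1 + N * N) = 1 + N ^ 4 := by
        rw [add_mul, mul_add, mul_add, one_mul, one_mul, mul_one,
          show 1 + N * N + (N * N + N * N * (N * N)) = 1 + (N * N + N * N) + N * N * (N * N) by abel,
          two, add_zero]
        simp only [pow_succ, pow_zero, one_mul, mul_assoc]
      rw [show (1 + N) ^ 4 = ((1 + N) * (1 + N)) * ((1 + N) * (1 + N)) by
        simp only [pow_succ, pow_zero, one_mul, mul_assoc], h2, h4, hN, add_zero]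
    refine ⟨1 + N, 1 + E, IsUnit.of_pow_eq_one hu (by norm_num), hu, ?_, ?_⟩
    · rw [add_mul, mul_add, mul_add, one_mul, one_mul, mul_one, hE, two, add_zero]
    · rw [hr, show 1 + N + (1 + E) = (1 + 1) + (E + N) by abel, two, zero_add]
  · intro k hk hk4 hclean
    obtain ⟨A, hA⟩ := exA n m hm
    obtain ⟨A', hA'⟩ := exA' n m hm
    interval_cases k
    · obtain ⟨u, e, -, hu, he, h⟩ := hclean A'
      rw [h] at hA'
      refine hno u e ?_ he hA'
      rw [pow_one] at hu
      rw [hu, one_mul]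
    · obtain ⟨u, e, -, hu, he, h⟩ := hclean A'
      rw [h] at hA'
      exact hno u e (by rw [← pow_two, hu]) he hA'
    · obtain ⟨u, e, -, hu, he, h⟩ := hclean A
      rw [h] at hA
      have huv : u * (u * u) = 1 := by rw [← hu]; simp only [pow_succ, pow_zero, one_mul, mul_assoc]
      have hvu : u * u * u = 1 := by rw [mul_assoc, huv]
      have hvv : u * u * (u * u) = u := by rw [mul_assoc, huv, mul_one]
      have hP : (u + u * u) * (u + u * u) = u + u * u := by
        rw [add_mul, mul_add, mul_add, huv, hvu, hvv, show u * u + 1 + (1 + u) =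
          (1 + 1) + (u + u * u) by abel, two, zero_add]
      exact count_aux n (u + u * u) (u * e + e * u) e hP
        (aux_T u (u * u) e rfl huv hvu hvv he hA)
        (aux_TP u (u * u) e rfl huv hvu hvv he hA)
        (aux_d u (u * u) e rfl huv hvu hvv he hA) hn
end

section
/- Let n > 2 be an integer. If n is 2-practical, then the full matrix ring 𝕄ₙ(𝔽₂) is almost n-torsion clean. -/
/-- `n` is 2-practical: `X^n - 1` over `𝔽₂` has a monic divisor of every degree `m`, `1 ≤ m ≤ n`. -/
def TwoPractical (n : ℕ) : Prop :=
  ∀ m : ℕ, 1 ≤ m → m ≤ n →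
    ∃ q : Polynomial (ZMod 2), q.Monic ∧ q.natDegree = m ∧ q ∣ (Polynomial.X ^ n - 1)

section Helpers
open Polynomial

lemma monic_of_ne_zero (f : (ZMod 2)[X]) (hf : f ≠ 0) : f.Monic := by
  have h : f.leadingCoeff ≠ 0 := leadingCoeff_ne_zero.mpr hf
  have : ∀ x : ZMod 2, x ≠ 0 → x = 1 := by decide
  exact this _ h

lemma X_smul_quot (f : (ZMod 2)[X]) (y : (ZMod 2)[X] ⧸ Ideal.span {f}) :
    (X : (ZMod 2)[X]) • y = (AdjoinRoot.root f * (show AdjoinRoot f from y) : AdjoinRoot f) := by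
  obtain ⟨p, rfl⟩ := Ideal.Quotient.mk_surjective y
  rfl

theorem assemble (n : ℕ) (hn : 0 < n)
    (block : ∀ f : (ZMod 2)[X], f.Monic → f.natDegree ≤ n →
      ∃ U E : Module.End (ZMod 2) (AdjoinRoot f), U ^ n = 1 ∧ E * E = E ∧
        ∀ x, AdjoinRoot.root f * x = U x + E x) :
    AlmostTorsionClean (Matrix (Fin n) (Fin n) (ZMod 2)) n := by
  intro r
  set T : Module.End (ZMod 2) (Fin n → ZMod 2) := Matrix.toLin' r with hT
  suffices H : ∃ U E : Module.End (ZMod 2) (Fin n → ZMod 2), U ^ n = 1 ∧ E * E = E ∧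
      T = U + E by
    obtain ⟨U, E, h1, h2, h3⟩ := H
    have hu : (LinearMap.toMatrixAlgEquiv' U) ^ n = 1 := by rw [← map_pow, h1, map_one]
    refine ⟨LinearMap.toMatrixAlgEquiv' U, LinearMap.toMatrixAlgEquiv' E,
      IsUnit.of_pow_eq_one hu hn.ne', hu, ?_, ?_⟩
    · rw [← map_mul, h2]
    · rw [← map_add, ← h3, hT]
      exact (LinearMap.toMatrix'_toLin' r).symm
  obtain ⟨ι, hι, p, hp, e, ⟨φ⟩⟩ := Module.equiv_directSum_of_isTorsion
    (R := (ZMod 2)[X]) (M := Module.AEval' T) (Module.AEval.isTorsion_of_finiteDimensional ..)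
  let f : ι → (ZMod 2)[X] := fun i => p i ^ e i
  have hf : ∀ i, (f i).Monic := fun i => monic_of_ne_zero _ (pow_ne_zero _ (hp i).ne_zero)
  classical
  let ψ0 : Module.AEval' T ≃ₗ[(ZMod 2)[X]] (Π i, (ZMod 2)[X] ⧸ Ideal.span {f i}) :=
    φ.trans (DirectSum.linearEquivFunOnFintype (ZMod 2)[X] ι
      (fun i => (ZMod 2)[X] ⧸ Ideal.span {f i}))
  let ψ : (Fin n → ZMod 2) ≃ₗ[ZMod 2] (Π i, AdjoinRoot (f i)) :=
    (Module.AEval'.of T).trans (ψ0.restrictScalars (ZMod 2))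
  have hψ : ∀ v i, ψ (T v) i = AdjoinRoot.root (f i) * ψ v i := by
    intro v i
    have : ψ0 (Module.AEval'.of T (T v)) = (X : (ZMod 2)[X]) • ψ0 (Module.AEval'.of T v) := by
      rw [← map_smul, Module.AEval'.X_smul_of]
    have h2 := congrFun this i
    exact h2.trans (X_smul_quot (f i) _)
  have hdeg : ∀ i, (f i).natDegree ≤ n := by
    intro i
    have h1 : Module.finrank (ZMod 2) (AdjoinRoot (f i)) = (f i).natDegree := by
      rw [(AdjoinRoot.powerBasis' (hf i)).finrank, AdjoinRoot.powerBasis'_dim]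
    have h2 := LinearMap.finrank_le_finrank_of_injective
      (f := ψ.symm.toLinearMap ∘ₗ LinearMap.single (ZMod 2) (fun i => AdjoinRoot (f i)) i)
      (ψ.symm.injective.comp
        (Pi.single_injective (M := fun i => AdjoinRoot (f i)) i))
    rw [h1] at h2
    simpa using h2
  choose U E hU hE hUE using fun i => block (f i) (hf i) (hdeg i)
  let conj := ψ.symm.conjRingEquiv (R₁ := ZMod 2)
  have hpow : ∀ k, (LinearMap.piMap U : Module.End (ZMod 2) (Π i, AdjoinRoot (f i))) ^ k =
      LinearMap.piMap (fun i => U i ^ k) := by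
    intro k
    induction k with
    | zero => ext; simp
    | succ k ih => rw [pow_succ, ih]; ext; simp [pow_succ]
  refine ⟨conj (LinearMap.piMap U), conj (LinearMap.piMap E), ?_, ?_, ?_⟩
  · rw [← map_pow, hpow, ← map_one conj]
    congr 1
    ext; simp [hU]
  · rw [← map_mul]
    congr 1
    refine LinearMap.ext fun x => funext fun i => ?_
    exact LinearMap.congr_fun (hE i) (x i)
  · rw [← map_add]
    refine LinearMap.ext fun v => ψ.injective (funext fun i => ?_)
    rw [hψ, hUE]
    simp [conj]

noncomputable def cf {f : (ZMod 2)[X]} (hf : f.Monic) (i : ℕ) : AdjoinRoot f →ₗ[ZMod 2] ZMod 2 :=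
  lcoeff (ZMod 2) i ∘ₗ AdjoinRoot.modByMonicHom hf

lemma cf_mk {f : (ZMod 2)[X]} (hf : f.Monic) (i : ℕ) (p : (ZMod 2)[X]) (hp : p.degree < f.degree) :
    cf hf i (AdjoinRoot.mk f p) = p.coeff i := by
  simp [cf, AdjoinRoot.modByMonicHom_mk, (modByMonic_eq_self_iff hf).2 hp]

lemma cf_root_pow {f : (ZMod 2)[X]} (hf : f.Monic) (i j : ℕ) (hj : j < f.natDegree) :
    cf hf i (AdjoinRoot.root f ^ j) = if i = j then 1 else 0 := by
  have := cf_mk hf i (X ^ j) (by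
    rw [degree_X_pow, degree_eq_natDegree hf.ne_zero]; exact_mod_cast hj)
  rw [map_pow, AdjoinRoot.mk_X, coeff_X_pow] at this
  exact this

lemma aeval_end_zero {f : (ZMod 2)[X]} (hf : f.Monic) (U : Module.End (ZMod 2) (AdjoinRoot f))
    (q : (ZMod 2)[X]) (h1 : aeval U q 1 = 0)
    (h2 : ∀ i < f.natDegree, ∃ g : (ZMod 2)[X], aeval U g 1 = AdjoinRoot.root f ^ i) :
    aeval U q = 0 := by
  refine (AdjoinRoot.powerBasis' hf).basis.ext fun i => ?_
  obtain ⟨g, hg⟩ := h2 i i.2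
  rw [PowerBasis.coe_basis]
  change aeval U q (AdjoinRoot.root f ^ (i : ℕ)) = 0
  rw [← hg, ← Module.End.mul_apply, ← map_mul, mul_comm, map_mul, Module.End.mul_apply, h1, map_zero]

lemma aeval_end_small {f : (ZMod 2)[X]} (U : Module.End (ZMod 2) (AdjoinRoot f)) (k : ℕ)
    (h : ∀ i < k, (U ^ i) 1 = AdjoinRoot.root f ^ i) (r : (ZMod 2)[X]) (hr : r.degree < k) :
    aeval U r 1 = AdjoinRoot.mk f r := by
  by_cases h0 : r = 0
  · simp [h0]
  have hr' : r.natDegree < k := (natDegree_lt_iff_degree_lt h0).2 hr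
  rw [aeval_eq_sum_range' hr', LinearMap.sum_apply]
  conv_rhs => rw [r.as_sum_range' k hr', map_sum]
  refine Finset.sum_congr rfl fun i hi => ?_
  rw [LinearMap.smul_apply, h i (Finset.mem_range.1 hi), ← C_mul_X_pow_eq_monomial, map_mul,
    map_pow, AdjoinRoot.mk_X, Algebra.smul_def]
  rfl

lemma pow_end {f : (ZMod 2)[X]} (U : Module.End (ZMod 2) (AdjoinRoot f)) (k : ℕ)
    (h : ∀ i < k, U (AdjoinRoot.root f ^ i) = AdjoinRoot.root f ^ (i + 1)) :
    ∀ i < k + 1, (U ^ i) 1 = AdjoinRoot.root f ^ i := by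
  intro i
  induction i with
  | zero => simp
  | succ i ih =>
    intro hi
    rw [pow_succ', Module.End.mul_apply, ih (by omega), h i (by omega)]

lemma degree_sub_lead (q : (ZMod 2)[X]) (hq : q.Monic) (d : ℕ) (hd : q.natDegree = d + 1) :
    (q - X ^ (d + 1)).degree < ((d + 1 : ℕ) : WithBot ℕ) := by
  have : q.degree = (d + 1 : ℕ) := by rw [degree_eq_natDegree hq.ne_zero, hd]
  rw [← this]
  exact degree_sub_lt_left (by rw [this, degree_X_pow]) hq.ne_zero (by rw [hq.leadingCoeff, leadingCoeff_X_pow])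

lemma block_one (f q : (ZMod 2)[X]) (hf : f.Monic) (hq : q.Monic) (d : ℕ)
    (hfd : f.natDegree = d + 1) (hqd : q.natDegree = d + 1) (hc : q.coeff d - f.coeff d = 1) :
    ∃ U E : Module.End (ZMod 2) (AdjoinRoot f), aeval U q = 0 ∧ E * E = E ∧
        ∀ x, AdjoinRoot.root f * x = U x + E x := by
  have hfdeg : f.degree = (d + 1 : ℕ) := by rw [degree_eq_natDegree hf.ne_zero, hfd]
  have hqdeg : q.degree = (d + 1 : ℕ) := by rw [degree_eq_natDegree hq.ne_zero, hqd]
  have hb : (q - f).degree < f.degree := by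
    rw [hfdeg, ← hqdeg]
    exact degree_sub_lt_left (by rw [hfdeg, hqdeg]) hq.ne_zero (by rw [hq.leadingCoeff, hf.leadingCoeff])
  let E : Module.End (ZMod 2) (AdjoinRoot f) :=
    (cf hf d).smulRight (AdjoinRoot.mk f (q - f))
  let U : Module.End (ZMod 2) (AdjoinRoot f) :=
    LinearMap.mulLeft (ZMod 2) (AdjoinRoot.root f) - E
  have hU : ∀ i < d, U (AdjoinRoot.root f ^ i) = AdjoinRoot.root f ^ (i + 1) := by
    intro i hi
    simp only [U, E, LinearMap.sub_apply, LinearMap.smulRight_apply, LinearMap.mulLeft_apply]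
    rw [cf_root_pow hf d i (by omega), if_neg (by omega), zero_smul, sub_zero, pow_succ']
  have hUd : U (AdjoinRoot.root f ^ d) = AdjoinRoot.root f ^ (d + 1) - AdjoinRoot.mk f q := by
    simp only [U, E, LinearMap.sub_apply, LinearMap.smulRight_apply, LinearMap.mulLeft_apply]
    rw [cf_root_pow hf d d (by omega), if_pos rfl, one_smul, pow_succ', map_sub,
      AdjoinRoot.mk_self, sub_zero]
  have hp := pow_end U d hU
  refine ⟨U, E, aeval_end_zero hf U q ?_ ?_, ?_, ?_⟩
  · have hs := aeval_end_small U (d + 1) hp _ (degree_sub_lead q hq d hqd)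
    have hl : (U ^ (d + 1)) 1 = AdjoinRoot.root f ^ (d + 1) - AdjoinRoot.mk f q := by
      rw [pow_succ', Module.End.mul_apply, hp d (by omega), hUd]
    rw [map_sub, map_pow, aeval_X, LinearMap.sub_apply, hl, map_sub, map_pow, AdjoinRoot.mk_X] at hs
    linear_combination hs
  · intro i hi
    exact ⟨X ^ i, by rw [map_pow, aeval_X, hp i (by omega)]⟩
  · refine LinearMap.ext fun x => ?_
    simp only [E, Module.End.mul_apply, LinearMap.smulRight_apply, map_smul, cf_mk hf d _ hb,
      coeff_sub, hc, one_smul]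
  · intro x
    simp [U]

lemma block_two (f q : (ZMod 2)[X]) (hf : f.Monic) (hq : q.Monic) (d : ℕ)
    (hfd : f.natDegree = d + 3) (hqd : q.natDegree = d + 3)
    (hc : q.coeff (d + 2) = f.coeff (d + 2)) :
    ∃ U E : Module.End (ZMod 2) (AdjoinRoot f), aeval U q = 0 ∧ E * E = E ∧
        ∀ x, AdjoinRoot.root f * x = U x + E x := by
  have hfdeg : f.degree = (d + 3 : ℕ) := by rw [degree_eq_natDegree hf.ne_zero, hfd]
  have hqdeg : q.degree = (d + 3 : ℕ) := by rw [degree_eq_natDegree hq.ne_zero, hqd]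
  have hqf : (q - f).degree < f.degree := by
    rw [hfdeg, ← hqdeg]
    exact degree_sub_lt_left (by rw [hfdeg, hqdeg]) hq.ne_zero (by rw [hq.leadingCoeff, hf.leadingCoeff])
  let c := q.coeff (d + 2)
  let α : ZMod 2 := q.coeff (d + 1) - f.coeff (d + 1) + 1 - c
  let a : (ZMod 2)[X] := X ^ (d + 1) + C α * X ^ d
  let b : (ZMod 2)[X] := (q - f) - X ^ (d + 2) + C (1 - c) * a - C α * X ^ (d + 1)
  have ha : a.degree < f.degree := by
    rw [hfdeg, degree_lt_iff_coeff_zero]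
    intro k hk
    have e1 : k ≠ d + 1 := by omega
    have e2 : k ≠ d := by omega
    simp [a, coeff_X_pow, e1, e2]
  have hb : b.degree < f.degree := by
    rw [hfdeg, degree_lt_iff_coeff_zero] at *
    intro k hk
    have e1 : k ≠ d + 1 := by omega
    have e3 : k ≠ d + 2 := by omega
    simp only [b, coeff_sub, coeff_add, coeff_C_mul, coeff_X_pow, e1, e3, ha k hk]
    have := hqf k hk
    rw [coeff_sub] at this
    simp [this]
  have ha1 : a.coeff (d + 1) = 1 := by simp [a, coeff_X_pow]
  have ha2 : a.coeff (d + 2) = 0 := by simp [a, coeff_X_pow]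
  have hb2 : b.coeff (d + 2) = 1 := by
    simp only [b, coeff_sub, coeff_add, coeff_C_mul, coeff_X_pow, ha2, hc]
    simp
  have hb1 : b.coeff (d + 1) = 0 := by
    simp only [b, coeff_sub, coeff_add, coeff_C_mul, coeff_X_pow, ha1]
    simp [α]
    ring
  let E : Module.End (ZMod 2) (AdjoinRoot f) :=
    (cf hf (d + 1)).smulRight (AdjoinRoot.mk f a) + (cf hf (d + 2)).smulRight (AdjoinRoot.mk f b)
  let U : Module.End (ZMod 2) (AdjoinRoot f) :=
    LinearMap.mulLeft (ZMod 2) (AdjoinRoot.root f) - E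
  have hUi : ∀ i < d + 3, U (AdjoinRoot.root f ^ i) = AdjoinRoot.root f ^ (i + 1)
      - (((if d + 1 = i then 1 else 0 : ZMod 2) • AdjoinRoot.mk f a) +
        ((if d + 2 = i then 1 else 0 : ZMod 2) • AdjoinRoot.mk f b)) := by
    intro i hi
    simp only [U, E, LinearMap.sub_apply, LinearMap.smulRight_apply, LinearMap.mulLeft_apply,
      LinearMap.add_apply]
    rw [cf_root_pow hf _ i (by omega), cf_root_pow hf _ i (by omega), pow_succ']
  have hU : ∀ i < d + 1, U (AdjoinRoot.root f ^ i) = AdjoinRoot.root f ^ (i + 1) := by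
    intro i hi
    rw [hUi i (by omega), if_neg (by omega), if_neg (by omega)]
    simp
  have hU1 : U (AdjoinRoot.root f ^ (d + 1)) =
      AdjoinRoot.root f ^ (d + 2) - AdjoinRoot.mk f a := by
    rw [hUi _ (by omega)]; simp
  have hU2 : U (AdjoinRoot.root f ^ (d + 2)) =
      AdjoinRoot.root f ^ (d + 3) - AdjoinRoot.mk f b := by
    rw [hUi _ (by omega)]; simp
  have hsm : ∀ (t : ZMod 2) (x : AdjoinRoot f), t • x = AdjoinRoot.of f t * x :=
    fun t x => Algebra.smul_def t x
  have hmka : AdjoinRoot.mk f a =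
      AdjoinRoot.root f ^ (d + 1) + α • AdjoinRoot.root f ^ d := by
    simp [a, hsm]
  have hmkb : AdjoinRoot.mk f b = AdjoinRoot.mk f q - AdjoinRoot.root f ^ (d + 2)
      + (1 - c) • AdjoinRoot.mk f a - α • AdjoinRoot.root f ^ (d + 1) := by
    simp [b, hsm]
  have hp := pow_end U (d + 1) hU
  have hp2 : (U ^ (d + 2)) 1 = AdjoinRoot.root f ^ (d + 2) - AdjoinRoot.mk f a := by
    rw [pow_succ', Module.End.mul_apply, hp (d + 1) (by omega), hU1]
  have hp3 : (U ^ (d + 3)) 1 = AdjoinRoot.root f ^ (d + 3) - AdjoinRoot.mk f b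
      - (AdjoinRoot.root f ^ (d + 2) - AdjoinRoot.mk f a + α • AdjoinRoot.root f ^ (d + 1)) := by
    rw [pow_succ', Module.End.mul_apply, hp2, map_sub, hU2, hmka, map_add, map_smul, hU1,
      hU d (by omega), hmka]
  refine ⟨U, E, aeval_end_zero hf U q ?_ ?_, ?_, ?_⟩
  · have hdeg : (q - X ^ (d + 3) - C c * X ^ (d + 2)).degree < ((d + 2 : ℕ) : WithBot ℕ) := by
      have h3 := degree_sub_lead q hq (d + 2) hqd
      rw [degree_lt_iff_coeff_zero] at *
      intro k hk
      rcases hk.eq_or_lt with rfl | hk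
      · simp [coeff_X_pow, c]
      · rw [coeff_sub, h3 k hk]
        have e3 : k ≠ d + 2 := by omega
        simp [coeff_X_pow, e3]
    have hs := aeval_end_small U (d + 2) hp _ hdeg
    rw [map_sub, map_sub, map_pow, map_mul, map_pow, aeval_X, LinearMap.sub_apply,
      LinearMap.sub_apply, hp3, hmkb, aeval_C, Module.End.mul_apply, Module.algebraMap_end_apply, hp2,
      map_sub, map_sub, map_mul, map_pow, map_pow, AdjoinRoot.mk_X, AdjoinRoot.mk_C] at hs
    simp only [hsm, map_sub, map_one] at hs
    linear_combination hs
  · intro i hi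
    by_cases h2 : i = d + 2
    · subst h2
      refine ⟨X ^ (d + 2) + a, ?_⟩
      have := aeval_end_small U (d + 2) hp a (by
        rw [degree_lt_iff_coeff_zero]
        intro k hk
        have e1 : k ≠ d + 1 := by omega
        have e2 : k ≠ d := by omega
        simp [a, coeff_X_pow, e1, e2])
      rw [map_add, map_pow, aeval_X, LinearMap.add_apply, hp2, this]
      ring
    · exact ⟨X ^ i, by rw [map_pow, aeval_X, hp i (by omega)]⟩
  · refine LinearMap.ext fun x => ?_
    simp only [E, Module.End.mul_apply, LinearMap.smulRight_apply, LinearMap.add_apply, map_add,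
      map_smul, cf_mk hf _ _ hb, cf_mk hf _ _ ha, ha1, ha2, hb1, hb2,
      one_smul, zero_smul, add_zero, zero_add]
  · intro x
    simp [U]

theorem block (n : ℕ) (hn : 0 < n)
   (h : ∀ m : ℕ, 1 ≤ m → m ≤ n →
    ∃ q : Polynomial (ZMod 2), q.Monic ∧ q.natDegree = m ∧ q ∣ (Polynomial.X ^ n - 1))
    (f : (ZMod 2)[X]) (hf : f.Monic) (hfn : f.natDegree ≤ n) :
      ∃ U E : Module.End (ZMod 2) (AdjoinRoot f), U ^ n = 1 ∧ E * E = E ∧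
        ∀ x, AdjoinRoot.root f * x = U x + E x := by
  rcases Nat.eq_zero_or_pos f.natDegree with h0 | h0
  · have : f = 1 := hf.natDegree_eq_zero.1 h0
    have hz : (1 : AdjoinRoot f) = 0 := by
      rw [← map_one (AdjoinRoot.mk f), AdjoinRoot.mk_eq_zero, this]
    have hs : Subsingleton (AdjoinRoot f) := subsingleton_of_zero_eq_one hz.symm
    exact ⟨1, 0, Subsingleton.elim _ _, Subsingleton.elim _ _, fun x => Subsingleton.elim _ _⟩
  obtain ⟨q, hq, hqd, hdvd⟩ := h _ h0 hfn
  have key : ∀ U : Module.End (ZMod 2) (AdjoinRoot f), aeval U q = 0 → U ^ n = 1 := by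
    intro U hU
    obtain ⟨g, hg⟩ := hdvd
    have := congrArg (aeval U) hg
    rw [map_mul, hU, zero_mul, map_sub, map_pow, aeval_X, map_one] at this
    exact sub_eq_zero.1 this
  suffices H : f.natDegree ≤ 2 ∧ q.coeff (f.natDegree - 1) = f.coeff (f.natDegree - 1) →
      ∃ U E : Module.End (ZMod 2) (AdjoinRoot f), U ^ n = 1 ∧ E * E = E ∧
        ∀ x, AdjoinRoot.root f * x = U x + E x by
    by_cases hc : q.coeff (f.natDegree - 1) = f.coeff (f.natDegree - 1)
    · by_cases h2 : f.natDegree ≤ 2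
      · exact H ⟨h2, hc⟩
      · obtain ⟨d, hd⟩ : ∃ d, f.natDegree = d + 3 := ⟨f.natDegree - 3, by omega⟩
        rw [hd] at hc hqd
        obtain ⟨U, E, h1, h2, h3⟩ := block_two f q hf hq d hd hqd hc
        exact ⟨U, E, key U h1, h2, h3⟩
    · obtain ⟨d, hd⟩ : ∃ d, f.natDegree = d + 1 := ⟨f.natDegree - 1, by omega⟩
      rw [hd] at hc hqd
      have e : ∀ x y : ZMod 2, x ≠ y → x - y = 1 := by decide
      obtain ⟨U, E, h1, h2, h3⟩ := block_one f q hf hq d hd hqd (e _ _ hc)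
      exact ⟨U, E, key U h1, h2, h3⟩
  rintro ⟨h2, hc⟩
  have hmul : ∀ p : (ZMod 2)[X], aeval (LinearMap.mulLeft (ZMod 2) (AdjoinRoot.root f)) p =
      LinearMap.mulLeft (ZMod 2) (AdjoinRoot.mk f p) := by
    intro p
    have := (aeval_algHom_apply (Algebra.lmul (ZMod 2) (AdjoinRoot f)) (AdjoinRoot.root f) p)
    rw [AdjoinRoot.aeval_eq] at this
    exact this
  by_cases hfq : q = f
  · refine ⟨LinearMap.mulLeft (ZMod 2) (AdjoinRoot.root f), 0, key _ ?_, by simp, by simp⟩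
    rw [hmul, hfq, AdjoinRoot.mk_self]
    simp
  -- constant terms
  have hq0 : q.coeff 0 = 1 := by
    have e : ∀ x : ZMod 2, x ≠ 0 → x = 1 := by decide
    apply e
    intro hz
    obtain ⟨g, hg⟩ := hdvd
    have := congrArg (fun p => coeff p 0) hg
    simp [mul_coeff_zero, hz, coeff_X_pow, hn.ne] at this
  have hd : f.natDegree = 2 := by
    by_contra hne
    have h1 : f.natDegree = 1 := by omega
    apply hfq
    rw [h1] at hqd hc
    rw [hq.eq_X_add_C hqd, hf.eq_X_add_C h1]
    simpa using hc
  rw [hd] at hqd hc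
  have hf0 : f.coeff 0 = 0 := by
    have e : ∀ x : ZMod 2, x ≠ 1 → x = 0 := by decide
    apply e
    intro hz
    apply hfq
    ext i
    match i with
    | 0 => rw [hq0, hz]
    | 1 => exact hc
    | 2 =>
      have e1 := hq.coeff_natDegree
      have e2 := hf.coeff_natDegree
      rw [hqd] at e1
      rw [hd] at e2
      rw [e1, e2]
    | i + 3 => rw [coeff_eq_zero_of_natDegree_lt (by omega), coeff_eq_zero_of_natDegree_lt (by omega)]
  have hfe : f = X ^ 2 + C (f.coeff 1) * X := by
    rw [hf.as_sum, hd]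
    simp [Finset.sum_range_succ, hf0]
  have hqe : q = X ^ 2 + C (f.coeff 1) * X + 1 := by
    rw [hq.as_sum, hqd]
    simp only [Finset.sum_range_succ, hq0, Finset.sum_range_zero, ← hc]
    simp; ring
  have hself : AdjoinRoot.root f ^ 2 + AdjoinRoot.of f (f.coeff 1) * AdjoinRoot.root f = 0 := by
    have := congrArg (AdjoinRoot.mk f) hfe
    rw [AdjoinRoot.mk_self] at this
    simpa using this.symm
  have htwo : (2 : AdjoinRoot f) = 0 := by
    have : AdjoinRoot.of f 2 = 0 := by
      rw [show (2 : ZMod 2) = 0 by decide, map_zero]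
    rwa [map_ofNat] at this
  have e : ∀ x : ZMod 2, x = 0 ∨ x = 1 := by decide
  rcases e (f.coeff 1) with h1 | h1
  · rw [h1] at hself hqe
    rw [map_zero] at hself
    refine ⟨LinearMap.mulLeft (ZMod 2) (AdjoinRoot.root f) + 1, 1, key _ ?_, by simp, ?_⟩
    · rw [hqe]
      refine LinearMap.ext fun x => ?_
      simp [pow_two, Module.End.mul_apply]
      linear_combination x * hself + (AdjoinRoot.root f * x + x) * htwo
    · intro x
      simp
      linear_combination - x * htwo
  · rw [h1, map_one] at hself
    refine ⟨1, LinearMap.mulLeft (ZMod 2) (AdjoinRoot.root f) + 1, by simp, ?_, ?_⟩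
    · refine LinearMap.ext fun x => ?_
      simp [Module.End.mul_apply]
      linear_combination x * hself 
    · intro x
      simp
      linear_combination - x * htwo

end Helpers

theorem Mn_F2_almost_n_torsion_clean_of_twoPractical (n : ℕ) (hn : 2 < n)
    (h : TwoPractical n) :
    AlmostTorsionClean (Matrix (Fin n) (Fin n) (ZMod 2)) n := by
  exact assemble n (by omega) (fun f hf hfn => block n (by omega) h f hf hfn)
end

section
/- The full matrix ring 𝕄₄₄(𝔽₂) is almost 44-torsion clean, yet 44 is not 2-practical; that is, there exists an integer m with 1 ≤ m ≤ 44 such that the polynomial X⁴⁴ − 1 over 𝔽₂ has no monic divisor of degree m. (Hence being almost n-torsion clean does not imply that n is 2-practical.) -/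
section Helpers

open Polynomial

theorem irr11 : Irreducible (cyclotomic 11 (ZMod 2)) := by
  have : Fact (Nat.Prime 2) := ⟨Nat.prime_two⟩
  have h2 : ¬ 2 ∣ 11 := by decide
  refine ZMod.irreducible_of_dvd_cyclotomic_of_natDegree h2 dvd_rfl ?_
  rw [natDegree_cyclotomic]
  have : Nat.totient 11 = 10 := by decide
  rw [this]
  symm
  rw [orderOf_eq_iff (by norm_num)]
  constructor
  · ext; simp; decide
  · intro m hm hm0 h
    have := congrArg Units.val h
    simp only [Units.val_pow_eq_pow_val, ZMod.coe_unitOfCoprime, Units.val_one] at this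
    revert this
    interval_cases m <;> decide

theorem no5 (q : (ZMod 2)[X]) (hd : q.natDegree = 5) (h : q ∣ X ^ 44 - 1) : False := by
  have : Fact (Nat.Prime 2) := ⟨Nat.prime_two⟩
  have : Fact (Nat.Prime 11) := ⟨by norm_num⟩
  have e : (X ^ 44 - 1 : (ZMod 2)[X]) = (cyclotomic 11 (ZMod 2)) ^ 4 * (X - 1) ^ 4 := by
    rw [← mul_pow, cyclotomic_prime_mul_X_sub_one]
    have h1 := sub_pow_char (R := (ZMod 2)[X]) (p := 2) (X ^ 11) 1
    have h2 := sub_pow_char (R := (ZMod 2)[X]) (p := 2) (X ^ 22) 1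
    calc (X ^ 44 - 1 : (ZMod 2)[X]) = (X ^ 22) ^ 2 - 1 ^ 2 := by ring
      _ = (X ^ 22 - 1) ^ 2 := h2.symm
      _ = ((X ^ 11) ^ 2 - 1 ^ 2) ^ 2 := by ring
      _ = _ := by rw [← h1]; ring
  rw [e] at h
  have hq : q ≠ 0 := by rintro rfl; simp at hd
  rcases (EuclideanDomain.dvd_or_coprime _ q irr11) with h1 | h1
  · have := natDegree_le_of_dvd h1 hq
    rw [natDegree_cyclotomic, hd] at this
    revert this; decide
  · have h3 : q ∣ (X - 1) ^ 4 := (h1.symm.pow_right).dvd_of_dvd_mul_left h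
    have h4 : (X - 1 : (ZMod 2)[X]).Monic := by simpa using monic_X_sub_C (1 : ZMod 2)
    have := natDegree_le_of_dvd h3 (h4.pow 4).ne_zero
    rw [natDegree_pow, hd] at this
    have h5 : (X - 1 : (ZMod 2)[X]).natDegree = 1 := by simpa using natDegree_X_sub_C (1 : ZMod 2)
    omega

/-- abstract block lemma -/
theorem block_s8 {V : Type*} [AddCommGroup V] [Module (ZMod 2) V] (T : V →ₗ[ZMod 2] V) (m : ℕ)
    (b : Module.Basis (Fin (m + 1)) (ZMod 2) V) (v : ℕ → V) (hb : ∀ i : Fin (m + 1), b i = v i)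
    (d : ℕ → Bool) (c : ℕ → ZMod 2)
    (hT : ∀ i < m, T (v i) = v (i + 1) + (if d i then v i else 0))
    (hTm : T (v m) = v m + ∑ j ∈ Finset.range m, c j • v j)
    (hadj : ∀ i < m, d i = true → i + 1 < m ∧ d (i + 1) = false)
    (hrun : ∀ i, i + 3 ≤ m → (d i = true ∨ d (i + 1) = true ∨ d (i + 2) = true) ∨
      (i + 3 = m ∧ ∀ j < m, d j = false)) :
    ∃ E N : V →ₗ[ZMod 2] V, (∀ x, T x = E x + N x) ∧ (∀ x, E (E x) = E x) ∧
      ∀ x, N (N (N (N x))) = 0 := by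
  classical
  let E : V →ₗ[ZMod 2] V := b.constr (ZMod 2) (fun i : Fin (m + 1) =>
    if (i : ℕ) = m then v m + ∑ j ∈ Finset.range m, (if d j then 0 else c j • v j)
    else if d i then v i + v (i + 1) else 0)
  have hE : ∀ i, i < m → E (v i) = if d i then v i + v (i + 1) else 0 := by
    intro i hi
    have := b.constr_basis (ZMod 2) (fun i : Fin (m + 1) =>
      if (i : ℕ) = m then v m + ∑ j ∈ Finset.range m, (if d j then 0 else c j • v j)
      else if d i then v i + v (i + 1) else 0) ⟨i, by omega⟩
    rw [hb] at this
    simp only [hi.ne, if_false] at this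
    exact this
  have hEm : E (v m) = v m + ∑ j ∈ Finset.range m, (if d j then 0 else c j • v j) := by
    have := b.constr_basis (ZMod 2) (fun i : Fin (m + 1) =>
      if (i : ℕ) = m then v m + ∑ j ∈ Finset.range m, (if d j then 0 else c j • v j)
      else if d i then v i + v (i + 1) else 0) ⟨m, by omega⟩
    rw [hb] at this
    simp only [if_true] at this
    exact this
  have hN : ∀ i, i < m → (T - E) (v i) = if d i then 0 else v (i + 1) := by
    intro i hi
    rw [LinearMap.sub_apply, hT i hi, hE i hi]
    split_ifs <;> abel
  have hNm : (T - E) (v m) = ∑ j ∈ Finset.range m, (if d j then c j • v j else 0) := by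
    rw [LinearMap.sub_apply, hTm, hEm, add_sub_add_left_eq_sub, ← Finset.sum_sub_distrib]
    refine Finset.sum_congr rfl fun j _ => ?_
    split_ifs <;> abel
  have hNNm : (T - E) ((T - E) (v m)) = 0 := by
    rw [hNm, map_sum]
    refine Finset.sum_eq_zero fun j hj => ?_
    have hj := Finset.mem_range.1 hj
    split_ifs with h
    · rw [map_smul, hN j hj, if_pos h, smul_zero]
    · simp
  have ext0 : ∀ (f g : V →ₗ[ZMod 2] V), (∀ i, i ≤ m → f (v i) = g (v i)) → ∀ x, f x = g x := by
    intro f g h x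
    have : f = g := b.ext fun i => by rw [hb]; exact h i (by omega)
    rw [this]
  refine ⟨E, T - E, fun x => by simp, ?_, ?_⟩
  · refine ext0 (E ∘ₗ E) E fun i hi => ?_
    rw [LinearMap.comp_apply]
    rcases hi.lt_or_eq with hi | rfl
    · rw [hE i hi]
      split_ifs with h
      · obtain ⟨h1, h2⟩ := hadj i hi h
        rw [map_add, hE i hi, hE _ h1, if_pos h, h2]; simp
      · simp
    · conv_lhs => rw [hEm, map_add]
      rw [add_eq_left, map_sum]
      refine Finset.sum_eq_zero fun j hj => ?_
      have hj := Finset.mem_range.1 hj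
      split_ifs with h
      · simp
      · rw [map_smul, hE j hj, if_neg h, smul_zero]
  · set N := T - E
    refine ext0 (N ∘ₗ N ∘ₗ N ∘ₗ N) 0 fun i hi => ?_
    simp only [LinearMap.comp_apply, LinearMap.zero_apply]
    have key : ∀ i, i + 1 ≤ m → d i = true → N (v i) = 0 := fun i hi h => by
      rw [hN i (by omega), if_pos h]
    have key0 : ∀ i, i + 1 ≤ m → ¬ d i = true → N (v i) = v (i + 1) := fun i hi h => by
      rw [hN i (by omega), if_neg h]
    rcases hi.lt_or_eq with hi | rfl
    swap
    · rw [hNNm]; simp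
    by_cases h0 : d i = true
    · rw [key i hi h0]; simp
    rw [key0 i hi h0]
    rcases (Nat.succ_le_of_lt hi).lt_or_eq with hi | hi
    swap
    · simp only [Nat.succ_eq_add_one] at hi
      rw [hi, hNNm]; simp
    by_cases h1 : d (i + 1) = true
    · rw [key _ hi h1]; simp
    rw [key0 _ hi h1]
    rcases (Nat.succ_le_of_lt hi).lt_or_eq with hi | hi
    swap
    · have : i + 1 + 1 = m := hi
      rw [this, hNNm]
    rcases hrun i hi with (h | h | h) | ⟨h, h'⟩
    · exact absurd h h0
    · exact absurd h h1
    · rw [key _ hi h]; simp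
    · rw [key0 _ hi (by rw [h' _ (by omega)]; simp)]
      have : i + 1 + 1 + 1 = m := by omega
      rw [this, hNm]
      refine Finset.sum_eq_zero fun j hj => ?_
      rw [h' j (Finset.mem_range.1 hj)]; simp

theorem pattern (m : ℕ) (t : ZMod 2) (hm : 2 ≤ m ∨ (m = 1 ∧ t = 1)) : ∃ d : ℕ → Bool, d m = true ∧
    (∑ j ∈ Finset.range (m + 1), (if d j then (1 : ZMod 2) else 0)) = t ∧
    (∀ i < m, d i = true → i + 1 < m ∧ d (i + 1) = false) ∧
    (∀ i, i + 3 ≤ m → (d i = true ∨ d (i + 1) = true ∨ d (i + 2) = true) ∨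
      (i + 3 = m ∧ ∀ j < m, d j = false)) := by
  rcases hm with hm | ⟨rfl, rfl⟩
  swap
  · refine ⟨fun j => decide (j = 1), by decide, by decide, by decide, ?_⟩
    intro i hi
    omega
  by_cases h3 : m = 3
  · subst h3
    have ht : t = 0 ∨ t = 1 := by revert t; decide
    rcases ht with rfl | rfl
    · refine ⟨fun j => decide (j % 2 = 1), by decide, by decide, by decide, ?_⟩
      intro i hi
      have : i = 0 := by omega
      subst this; decide
    · refine ⟨fun j => decide (j = 3), by decide, by decide, by decide, ?_⟩
      intro i hi
      have : i = 0 := by omega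
      subst this; decide
  let s : ℕ → Bool := fun k => decide (k % 2 = 0)
  let s' : ℕ → Bool := fun k => if k < 6 then decide (k % 3 = 0) else decide (k % 2 = 0)
  have hdiff : ∀ n, (∑ j ∈ Finset.range (n + 6), (if s' j then (1 : ZMod 2) else 0)) =
      (∑ j ∈ Finset.range (n + 6), (if s j then (1 : ZMod 2) else 0)) + 1 := by
    intro n
    induction n with
    | zero => decide
    | succ n ih =>
      rw [show n + 1 + 6 = (n + 6) + 1 by ring, Finset.sum_range_succ, Finset.sum_range_succ _ (n+6), ih]
      have : s' (n + 6) = s (n + 6) := by simp [s, s']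
      rw [this]; ring
  have hdiff' : (∑ j ∈ Finset.range (m + 1), (if s' j then (1 : ZMod 2) else 0)) =
      (∑ j ∈ Finset.range (m + 1), (if s j then (1 : ZMod 2) else 0)) + 1 := by
    by_cases h5 : 5 ≤ m
    · obtain ⟨n, rfl⟩ := Nat.exists_eq_add_of_le h5
      rw [show 5 + n + 1 = n + 6 by ring]; exact hdiff n
    · have : m = 2 ∨ m = 4 := by omega
      rcases this with rfl | rfl <;> decide
  have two : ∀ a t : ZMod 2, t = a ∨ t = a + 1 := by decide
  have main : ∀ s : ℕ → Bool, s 0 = true →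
      (∑ j ∈ Finset.range (m + 1), (if s j then (1 : ZMod 2) else 0)) = t →
      (∀ k, s (k + 1) = true → 0 < k ∧ s k = false) →
      (∀ k, s (k + 1) = true ∨ s (k + 2) = true ∨ s (k + 3) = true) → ∃ d : ℕ → Bool, d m = true ∧
    (∑ j ∈ Finset.range (m + 1), (if d j then (1 : ZMod 2) else 0)) = t ∧
    (∀ i < m, d i = true → i + 1 < m ∧ d (i + 1) = false) ∧
    (∀ i, i + 3 ≤ m → (d i = true ∨ d (i + 1) = true ∨ d (i + 2) = true) ∨
      (i + 3 = m ∧ ∀ j < m, d j = false)) := by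
    intro s h0 hs h1 h2
    refine ⟨fun j => s (m - j), by simpa using h0, ?_, ?_, ?_⟩
    · rw [← hs, ← Finset.sum_range_reflect]
      simp only [Nat.add_sub_cancel]
      refine Finset.sum_congr rfl fun j hj => ?_
      rw [show m - (m - j) = j by have := Finset.mem_range.1 hj; omega]
    · intro i hi h
      obtain ⟨k, hk⟩ : ∃ k, m - i = k + 1 := ⟨m - i - 1, by omega⟩
      simp only [hk] at h
      obtain ⟨h3, h4⟩ := h1 k h
      refine ⟨by omega, ?_⟩
      simp only
      rw [show m - (i + 1) = k by omega, h4]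
    · intro i hi
      left
      obtain ⟨k, hk⟩ : ∃ k, m = i + 3 + k := ⟨m - i - 3, by omega⟩
      simp only [show m - i = k + 3 by omega, show m - (i + 1) = k + 2 by omega,
        show m - (i + 2) = k + 1 by omega]
      rcases h2 k with h | h | h <;> simp [h]
  rcases two (∑ j ∈ Finset.range (m + 1), (if s j then (1 : ZMod 2) else 0)) t with h | h
  · refine main s (by decide) h.symm ?_ ?_
    · intro k; simp only [s, decide_eq_true_eq, decide_eq_false_iff_not]; omega
    · intro k; simp only [s, decide_eq_true_eq]; omega
  · refine main s' (by decide) (by rw [h, hdiff']) ?_ ?_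
    · intro k; simp only [s']; split_ifs <;> simp only [decide_eq_true_eq, decide_eq_false_iff_not] <;> omega
    · intro k; simp only [s']; split_ifs <;> simp only [decide_eq_true_eq] <;> omega

noncomputable def pseq (d : ℕ → Bool) (i : ℕ) : (ZMod 2)[X] :=
  ∏ j ∈ Finset.range i, (X - C (if d j then (1 : ZMod 2) else 0))

theorem pseq_monic (d : ℕ → Bool) (i : ℕ) : (pseq d i).Monic :=
  monic_prod_of_monic _ _ fun _ _ => monic_X_sub_C _

theorem pseq_natDegree (d : ℕ → Bool) (i : ℕ) : (pseq d i).natDegree = i := by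
  rw [pseq, natDegree_prod_of_monic _ _ fun _ _ => monic_X_sub_C _]
  simp only [natDegree_X_sub_C]; simp

theorem pseq_succ (d : ℕ → Bool) (i : ℕ) :
    pseq d (i + 1) = pseq d i * (X - C (if d i then (1 : ZMod 2) else 0)) := by
  rw [pseq, Finset.prod_range_succ, pseq]

noncomputable def pseqS (d : ℕ → Bool) : Polynomial.Sequence (ZMod 2) where
  elems' := pseq d
  degree_eq' i := by
    rw [degree_eq_natDegree (pseq_monic d i).ne_zero, pseq_natDegree]

theorem pseqS_apply (d : ℕ → Bool) (i : ℕ) : pseqS d i = pseq d i := rfl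

def Good (M : Type*) [AddCommGroup M] (T : M →+ M) : Prop :=
  ∃ E N : M →+ M, (∀ x, T x = E x + N x) ∧ (∀ x, E (E x) = E x) ∧
    ∀ x, N (N (N (N x))) = 0

abbrev GoodR (p : (ZMod 2)[X]) : Prop :=
  Good (AdjoinRoot p) (AddMonoidHom.mulLeft (AdjoinRoot.root p))

theorem good_big (p : (ZMod 2)[X]) (hp : p.Monic) (m : ℕ) (hm : 2 ≤ m ∨ (m = 1 ∧ p.nextCoeff = 1))
    (hd : p.natDegree = m + 1) : GoodR p := by
  obtain ⟨d, hdm, hsum, hadj, hrun⟩ := pattern m (-p.nextCoeff)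
    (hm.imp id fun h => ⟨h.1, by rw [h.2]; decide⟩)
  have hnext : (pseq d (m + 1)).nextCoeff = p.nextCoeff := by
    rw [pseq, prod_X_sub_C_nextCoeff, hsum, neg_neg]
  have hdeg : pseq d (m + 1) - p ∈ degreeLT (ZMod 2) m := by
    rw [mem_degreeLT, degree_lt_iff_coeff_zero]
    intro k hk
    rw [coeff_sub]
    rcases hk.eq_or_lt with rfl | hk
    · rw [nextCoeff_of_natDegree_pos (by rw [pseq_natDegree]; omega),
        nextCoeff_of_natDegree_pos (by omega), pseq_natDegree, hd] at hnext
      simp only [Nat.add_sub_cancel] at hnext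
      rw [hnext, sub_self]
    rcases (Nat.succ_le_of_lt hk).eq_or_lt with hk | hk
    · have h1 := (pseq_monic d (m + 1)).coeff_natDegree
      have h2 := hp.coeff_natDegree
      rw [pseq_natDegree] at h1
      rw [hd] at h2
      rw [← hk, Nat.succ_eq_add_one, h1, h2, sub_self]
    · rw [coeff_eq_zero_of_natDegree_lt (by rw [pseq_natDegree]; exact hk),
        coeff_eq_zero_of_natDegree_lt (by rw [hd]; exact hk), sub_self]
  have hunit : ∀ i < m, IsUnit (pseqS d i).leadingCoeff := fun i _ => by
    rw [pseqS_apply, (pseq_monic d i).leadingCoeff]; exact isUnit_one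
  rw [← (pseqS d).span_degreeLT hunit, ← Finset.coe_range,
    Submodule.mem_span_image_finset_iff_exists_fun] at hdeg
  obtain ⟨c, hc⟩ : ∃ c : ℕ → ZMod 2,
      ∑ i ∈ Finset.range m, c i • pseqS d i = pseq d (m + 1) - p := by
    obtain ⟨c, hc⟩ := hdeg
    refine ⟨fun i => if h : i ∈ Finset.range m then c ⟨i, h⟩ else 0, ?_⟩
    rw [← hc, ← Finset.sum_coe_sort]
    exact Finset.sum_congr rfl fun i _ => by beta_reduce; rw [dif_pos i.2]
  let v : ℕ → AdjoinRoot p := fun i => AdjoinRoot.mk p (pseq d i)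
  have hsm : ∀ (a : ZMod 2) (f : (ZMod 2)[X]), AdjoinRoot.mk p (a • f) = a • AdjoinRoot.mk p f :=
    fun a f => (AdjoinRoot.smul_mk (f := p) a f).symm
  have hli : LinearIndependent (ZMod 2) (fun i : Fin (m + 1) => v i) := by
    rw [Fintype.linearIndependent_iff]
    intro g hg
    have h0 : AdjoinRoot.mk p (∑ i : Fin (m + 1), g i • pseq d i) = 0 := by
      rw [map_sum, ← hg]
      exact Finset.sum_congr rfl fun i _ => hsm _ _
    rw [AdjoinRoot.mk_eq_zero] at h0
    have h1 : ∑ i : Fin (m + 1), g i • pseq d i = 0 := by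
      refine eq_zero_of_dvd_of_degree_lt h0 ?_
      rw [degree_eq_natDegree hp.ne_zero, hd, ← mem_degreeLT]
      refine Submodule.sum_mem _ fun i _ => Submodule.smul_mem _ _ ?_
      rw [mem_degreeLT, degree_eq_natDegree (pseq_monic d i).ne_zero, pseq_natDegree]
      exact_mod_cast i.2
    have h2 := (pseqS d).linearIndependent.comp (fun i : Fin (m + 1) => (i : ℕ)) Fin.val_injective
    exact Fintype.linearIndependent_iff.1 h2 g h1
  have hfin : Fintype.card (Fin (m + 1)) = Module.finrank (ZMod 2) (AdjoinRoot p) := by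
    rw [(AdjoinRoot.powerBasis' hp).finrank, AdjoinRoot.powerBasis'_dim, hd, Fintype.card_fin]
  obtain ⟨E, N, h1, h2, h3⟩ := block_s8 (LinearMap.mulLeft (ZMod 2) (AdjoinRoot.root p)) m
    (basisOfLinearIndependentOfCardEqFinrank hli hfin) v (fun i => by simp) d c
    (fun i hi => by
      have : X * pseq d i = pseq d (i + 1) + (if d i then pseq d i else 0) := by
        rw [pseq_succ]; split_ifs <;> simp <;> ring
      have := congrArg (AdjoinRoot.mk p) this
      rw [map_mul, map_add, AdjoinRoot.mk_X] at this
      rw [LinearMap.mulLeft_apply, this]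
      split_ifs <;> simp [v])
    (by
      have : X * pseq d m = pseq d m + (∑ i ∈ Finset.range m, c i • pseqS d i) + p := by
        rw [hc, pseq_succ, hdm]; simp; ring
      have := congrArg (AdjoinRoot.mk p) this
      rw [map_mul, map_add, map_add, AdjoinRoot.mk_X, AdjoinRoot.mk_self, add_zero, map_sum] at this
      rw [LinearMap.mulLeft_apply, this]
      congr 1)
    hadj hrun
  exact ⟨E.toAddMonoidHom, N.toAddMonoidHom,
    h1, h2, h3⟩

theorem good_of_dvd_X (p : (ZMod 2)[X]) (h : p ∣ X ^ 4) : GoodR p := by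
  refine ⟨0, AddMonoidHom.mulLeft (AdjoinRoot.root p), fun x => ?_, fun x => by simp, fun x => ?_⟩
  · simp
  · have : AdjoinRoot.root p ^ 4 = 0 := by
      rw [← AdjoinRoot.mk_X, ← map_pow, AdjoinRoot.mk_eq_zero]; exact h
    simp only [AddMonoidHom.coe_mulLeft]
    linear_combination x * this

theorem good_of_dvd_X_sub (p : (ZMod 2)[X]) (h : p ∣ (X - 1) ^ 4) : GoodR p := by
  refine ⟨AddMonoidHom.id _, AddMonoidHom.mulLeft (AdjoinRoot.root p - 1), fun x => ?_,
    fun x => by simp, fun x => ?_⟩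
  · simp only [AddMonoidHom.coe_mulLeft, AddMonoidHom.id_apply]; ring
  · have : (AdjoinRoot.root p - 1) ^ 4 = 0 := by
      rw [← AdjoinRoot.mk_X, ← map_one (AdjoinRoot.mk p), ← map_sub, ← map_pow,
        AdjoinRoot.mk_eq_zero]; exact h
    simp only [AddMonoidHom.coe_mulLeft]
    linear_combination x * this

theorem good_one (p : (ZMod 2)[X]) (hp : p.Monic) : GoodR p := by
  by_cases h3 : 3 ≤ p.natDegree
  · exact good_big p hp (p.natDegree - 1) (Or.inl (by omega)) (by omega)
  have hz : ∀ a : ZMod 2, a = 0 ∨ a = 1 := by decide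
  have hc : p.coeff p.natDegree = 1 := hp
  have h : p.natDegree = 0 ∨ p.natDegree = 1 ∨ p.natDegree = 2 := by omega
  have h20 : (2 : (ZMod 2)[X]) = 0 := CharTwo.two_eq_zero
  have hexp : p = C (p.coeff 0) + C (p.coeff 1) * X + C (p.coeff 2) * X ^ 2 := by
    conv_lhs => rw [p.as_sum_range_C_mul_X_pow' (n := 3) (by omega)]
    simp [Finset.sum_range_succ]
  have hnc : p.natDegree = 2 → p.coeff 1 = 1 → p.nextCoeff = 1 := fun h h1 => by
    rw [nextCoeff_of_natDegree_pos (by omega), h]; exact h1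
  rcases h with h | h | h <;> rw [h] at hc
  · rw [hp.natDegree_eq_zero.1 h]
    exact good_of_dvd_X _ (one_dvd _)
  · rw [coeff_eq_zero_of_natDegree_lt (n := 2) (by omega), hc] at hexp
    rcases hz (p.coeff 0) with h0 | h0 <;> rw [h0] at hexp <;> simp at hexp
    · rw [hexp]; exact good_of_dvd_X _ (dvd_pow_self _ (by norm_num))
    · rw [hexp]; refine good_of_dvd_X_sub _ ⟨(X - 1) ^ 3, ?_⟩
      linear_combination -h20 * (X - 1) ^ 3
  · rw [hc] at hexp
    rcases hz (p.coeff 0) with h0 | h0 <;> rcases hz (p.coeff 1) with h1 | h1 <;>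
      rw [h0, h1] at hexp <;> simp at hexp
    · rw [hexp]; exact good_of_dvd_X _ (pow_dvd_pow _ (by norm_num))
    · exact good_big p hp 1 (Or.inr ⟨rfl, hnc h h1⟩) h
    · rw [hexp]; refine good_of_dvd_X_sub _ ⟨(X - 1) ^ 2, ?_⟩
      linear_combination -h20 * X * (X - 1) ^ 2
    · exact good_big p hp 1 (Or.inr ⟨rfl, hnc h h1⟩) h

theorem good_quot (p : (ZMod 2)[X]) (hp : p ≠ 0) :
    Good ((ZMod 2)[X] ⧸ Submodule.span (ZMod 2)[X] {p})
      (LinearMap.lsmul (ZMod 2)[X] _ (X : (ZMod 2)[X])).toAddMonoidHom := by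
  have h1 : ∀ a : ZMod 2, a ≠ 0 → a = 1 := by decide
  obtain ⟨E, N, h⟩ := good_one p (h1 _ (leadingCoeff_ne_zero.2 hp))
  refine ⟨E, N, fun x => Eq.trans ?_ (h.1 x), h.2⟩
  obtain ⟨f, rfl⟩ := Submodule.Quotient.mk_surjective _ x
  rfl

theorem good_module (M : Type) [AddCommGroup M] [Module (ZMod 2)[X] M]
    [Module.Finite (ZMod 2)[X] M] (hM : Module.IsTorsion (ZMod 2)[X] M) :
    Good M (LinearMap.lsmul (ZMod 2)[X] _ (X : (ZMod 2)[X])).toAddMonoidHom := by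
  classical
  obtain ⟨ι, _, p, hp, e, ⟨φ⟩⟩ := Module.equiv_directSum_of_isTorsion hM
  have hg := fun i => good_quot (p i ^ e i) (pow_ne_zero _ (hp i).ne_zero)
  choose E N h1 h2 h3 using hg
  let EE : (DirectSum ι fun i => (ZMod 2)[X] ⧸ Submodule.span (ZMod 2)[X] {p i ^ e i}) →+
      (DirectSum ι fun i => (ZMod 2)[X] ⧸ Submodule.span (ZMod 2)[X] {p i ^ e i}) := DFinsupp.mapRange.addMonoidHom E
  let NN : (DirectSum ι fun i => (ZMod 2)[X] ⧸ Submodule.span (ZMod 2)[X] {p i ^ e i}) →+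
      (DirectSum ι fun i => (ZMod 2)[X] ⧸ Submodule.span (ZMod 2)[X] {p i ^ e i}) := DFinsupp.mapRange.addMonoidHom N
  refine ⟨φ.symm.toAddEquiv.toAddMonoidHom.comp (EE.comp φ.toAddEquiv.toAddMonoidHom),
    φ.symm.toAddEquiv.toAddMonoidHom.comp (NN.comp φ.toAddEquiv.toAddMonoidHom), fun x => ?_, fun x => ?_, fun x => ?_⟩
  · apply φ.injective
    have : φ ((X : (ZMod 2)[X]) • x) = EE (φ x) + NN (φ x) := by
      rw [map_smul]
      refine DFinsupp.ext fun i => ?_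
      exact h1 i _
    simpa using this
  · have : EE (EE (φ x)) = EE (φ x) := DFinsupp.ext fun i => h2 i _
    simpa using this
  · have : NN (NN (NN (NN (φ x)))) = 0 := DFinsupp.ext fun i => h3 i _
    simpa using this

theorem matrix_clean (n : ℕ) (A : Matrix (Fin n) (Fin n) (ZMod 2)) :
    ∃ E N : Matrix (Fin n) (Fin n) (ZMod 2), A = E + N ∧ E * E = E ∧ N ^ 4 = 0 := by
  obtain ⟨E, N, h1, h2, h3⟩ := good_module (Module.AEval' (Matrix.toLin' A))
    (Module.AEval.isTorsion_of_finiteDimensional _ _ _)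
  let o := Module.AEval'.of (Matrix.toLin' A)
  let E' : (Fin n → ZMod 2) →ₗ[ZMod 2] (Fin n → ZMod 2) :=
    o.symm.toLinearMap ∘ₗ (E.toZModLinearMap 2) ∘ₗ o.toLinearMap
  let N' : (Fin n → ZMod 2) →ₗ[ZMod 2] (Fin n → ZMod 2) :=
    o.symm.toLinearMap ∘ₗ (N.toZModLinearMap 2) ∘ₗ o.toLinearMap
  have e1 : Matrix.toLin' A = E' + N' := by
    refine LinearMap.ext fun x => o.injective ?_
    have := h1 (o x)
    simp only [E', N', LinearMap.add_apply, LinearMap.comp_apply, map_add,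
      LinearEquiv.coe_coe, LinearEquiv.apply_symm_apply, AddMonoidHom.coe_toZModLinearMap]
    rw [← this]
    exact (Module.AEval'.X_smul_of _ x).symm
  have e2 : E' ∘ₗ E' = E' := LinearMap.ext fun x => by
    simp [E', h2]
  have e3 : N' ^ 4 = 0 := LinearMap.ext fun x => by
    simp [pow_succ, N', h3]
  refine ⟨LinearMap.toMatrix' E', LinearMap.toMatrix' N', ?_, ?_, ?_⟩
  · rw [← map_add, ← e1, LinearMap.toMatrix'_toLin']
  · rw [← LinearMap.toMatrix'_comp, e2]
  · have : LinearMap.toMatrixAlgEquiv' (N' ^ 4) = (LinearMap.toMatrixAlgEquiv' N') ^ 4 := map_pow _ _ _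
    rw [e3, map_zero] at this
    exact this.symm

end Helpers

theorem M44_almost_torsion_clean_not_twoPractical :
    AlmostTorsionClean (Matrix (Fin 44) (Fin 44) (ZMod 2)) 44 ∧
    ¬ TwoPractical 44 ∧
    ∃ m : ℕ, 1 ≤ m ∧ m ≤ 44 ∧
      ¬ ∃ q : Polynomial (ZMod 2), q.Monic ∧ q.natDegree = m ∧
        q ∣ (Polynomial.X ^ 44 - 1) := by
  have h5 : ¬ ∃ q : Polynomial (ZMod 2), q.Monic ∧ q.natDegree = 5 ∧
        q ∣ (Polynomial.X ^ 44 - 1) := fun ⟨q, _, hd, hq⟩ => no5 q hd hq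
  refine ⟨fun r => ?_, fun h => h5 (h 5 (by norm_num) (by norm_num)),
    5, by norm_num, by norm_num, h5⟩
  obtain ⟨E, N, h1, h2, h3⟩ := matrix_clean 44 (r - 1)
  have h20 : (2 : Matrix (Fin 44) (Fin 44) (ZMod 2)) = 0 := by
    have : (2 : ZMod 2) = 0 := by decide
    rw [← map_ofNat (algebraMap (ZMod 2) (Matrix (Fin 44) (Fin 44) (ZMod 2))) 2, this, map_zero]
  have hu : (1 + N) ^ 4 = 1 := by
    have : (1 + N) ^ 4 = 1 + 2 * (2 * N + 3 * N ^ 2 + 2 * N ^ 3) + N ^ 4 := by noncomm_ring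
    rw [this, h20, h3]; simp
  refine ⟨1 + N, E, IsUnit.of_pow_eq_one hu (by norm_num), ?_, h2, ?_⟩
  · exact (pow_mul (1 + N) 4 11).trans (by rw [hu, one_pow])
  · rw [add_assoc, add_comm N E, ← h1]; abel
end
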